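/- A sequence (i_1, …, i_k) of integers is the target residue sequence of an up-down tableau of shape ∅ (the empty Young diagram) if and only if its stacked diagram is orientable. -/

import Mathlib

/-- One step of an up-down tableau together with its target residue: `ν` is obtained from
`μ` by adding a box `b` (target residue `col b - row b`) or by removing a box `b`
(target residue `col b - row b - 1`). -/
def UDStepRes (μ ν : YoungDiagram) (r : ℤ) : Prop :=
  (∃ b : ℕ × ℕ, b ∉ μ.cells ∧ ν.cells = insert b μ.cells ∧ r = (b.2 : ℤ) - (b.1 : ℤ)) ∨
  (∃ b : ℕ × ℕ, b ∈ μ.cells ∧ ν.cells = μ.cells.erase b ∧ r = (b.2 : ℤ) - (b.1 : ℤ) - 1)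

/-- `IsUDTab μ l ν` holds if `l` is the target residue sequence of an up-down tableau
starting at `μ` and ending at `ν`. -/
def IsUDTab : YoungDiagram → List ℤ → YoungDiagram → Prop
  | μ, [], ν => μ = ν
  | μ, r :: rs, ν => ∃ μ', UDStepRes μ μ' r ∧ IsUDTab μ' rs ν

/-- A rational number is a *half-integer*, i.e. of the form `k + 1/2` for an integer `k`. -/
def IsHalfInt (q : ℚ) : Prop := ∃ k : ℤ, q = (k : ℚ) + 1/2

/-- Adjacency in the stacked diagram of the integer sequence `il`: vertices are pairs
(position, level), level `0` at the top and level `il.length` at the bottom.  The layer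
between levels `m` and `m + 1` has residue `a = il[m]` and contributes vertical edges at
all half-integer positions other than `a - 1/2` and `a + 1/2`, an arc joining
`(a - 1/2, m)` and `(a + 1/2, m)`, and an arc joining `(a - 1/2, m + 1)` and
`(a + 1/2, m + 1)`. -/
def StackAdj (il : List ℤ) (v w : ℚ × ℕ) : Prop :=
  ∃ (m : ℕ) (a : ℤ), il[m]? = some a ∧
    ((IsHalfInt v.1 ∧ v.1 ≠ (a : ℚ) - 1/2 ∧ v.1 ≠ (a : ℚ) + 1/2 ∧
        w.1 = v.1 ∧ v.2 = m ∧ w.2 = m + 1) ∨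
     (v = ((a : ℚ) - 1/2, m) ∧ w = ((a : ℚ) + 1/2, m)) ∨
     (v = ((a : ℚ) - 1/2, m + 1) ∧ w = ((a : ℚ) + 1/2, m + 1)))

/-- Two vertices lie in the same connected component of the stacked diagram. -/
def StackReach (il : List ℤ) : ℚ × ℕ → ℚ × ℕ → Prop :=
  Relation.ReflTransGen (fun v w => StackAdj il v w ∨ StackAdj il w v)

/-- The stacked diagram of `il` is *orientable*: it contains no circle (no connected
component avoiding both boundary levels `0` and `il.length`), every path with two free
ends at level `0` has its end positions on opposite sides of `0`, and every path with two
free ends at level `il.length` has its end positions on opposite sides of `-1`. -/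
def StackOrientable (il : List ℤ) : Prop :=
  (¬ ∃ v : ℚ × ℕ, IsHalfInt v.1 ∧ 0 < v.2 ∧ v.2 < il.length ∧
      ∀ w : ℚ × ℕ, StackReach il v w → 0 < w.2 ∧ w.2 < il.length) ∧
  (∀ p q : ℚ, IsHalfInt p → IsHalfInt q → p ≠ q → StackReach il (p, 0) (q, 0) →
      (p < 0 ∧ 0 < q) ∨ (q < 0 ∧ 0 < p)) ∧
  (∀ p q : ℚ, IsHalfInt p → IsHalfInt q → p ≠ q →
      StackReach il (p, il.length) (q, il.length) →
      (p < -1 ∧ -1 < q) ∨ (q < -1 ∧ -1 < p))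

namespace UDT

def US (g : ℤ → ℤ) : Prop := ∀ j, g (j+1) = g j + 1 ∨ g (j+1) = g j - 1
def Mt (g : ℤ → ℤ) (x y : ℤ) : Prop := x < y ∧ g (y+1) = g x ∧ ∀ j, x < j → j ≤ y → g x < g j
def MM (g : ℤ → ℤ) (x y : ℤ) : Prop := Mt g x y ∨ Mt g y x
def UR (g : ℤ → ℤ) (x : ℤ) : Prop := ∀ j, x < j → g x < g j
def UL (g : ℤ → ℤ) (x : ℤ) : Prop := ∀ j, j ≤ x → g (x+1) < g j
def Vis (g : ℤ → ℤ) (i j : ℤ) : Prop :=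
  g i = g j ∧ ∀ k, (i ≤ k ∧ k ≤ j ∨ j ≤ k ∧ k ≤ i) → g i ≤ g k
def Dip (g : ℤ → ℤ) (i : ℤ) : Prop := ∃ k, i < k ∧ g k < g i

theorem MM.symm {g x y} (h : MM g x y) : MM g y x := Or.symm h

theorem exists_least {P : ℤ → Prop} {b : ℤ} (hb : ∀ z, P z → b ≤ z) (h : ∃ z, P z) :
    ∃ m, P m ∧ ∀ z, z < m → ¬ P z := by
  obtain ⟨m, hm, h2⟩ := Int.exists_least_of_bdd ⟨b, hb⟩ h
  exact ⟨m, hm, fun z hz hp => by have := h2 z hp; omega⟩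

theorem exists_greatest {P : ℤ → Prop} {b : ℤ} (hb : ∀ z, P z → z ≤ b) (h : ∃ z, P z) :
    ∃ m, P m ∧ ∀ z, m < z → ¬ P z := by
  obtain ⟨m, hm, h2⟩ := Int.exists_greatest_of_bdd ⟨b, hb⟩ h
  exact ⟨m, hm, fun z hz hp => by have := h2 z hp; omega⟩

theorem up_cases {g x} (hg : US g) (hx : g (x+1) = g x + 1) : UR g x ∨ ∃ y, Mt g x y := by
  by_cases h : UR g x
  · exact Or.inl h
  right
  simp only [UR] at h
  push Not at h
  obtain ⟨m, ⟨h1, h2⟩, h3⟩ := exists_least (P := fun j => x < j ∧ g j ≤ g x) (b := x) (fun z hz => by omega) h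
  have h4 := h3 (m-1) (by omega)
  have h5 := hg (m-1)
  have h6 : m - 1 + 1 = m := by omega
  rw [h6] at h5
  have h7 : m ≠ x + 1 := by rintro rfl; omega
  refine ⟨m-1, by omega, by rw [h6]; omega, fun j hj hj2 => ?_⟩
  have := h3 j (by omega)
  omega

theorem down_cases {g x} (hg : US g) (hx : g (x+1) = g x - 1) : UL g x ∨ ∃ y, Mt g y x := by
  by_cases h : UL g x
  · exact Or.inl h
  right
  simp only [UL] at h
  push Not at h
  obtain ⟨m, ⟨h1, h2⟩, h3⟩ := exists_greatest (P := fun j => j ≤ x ∧ g j ≤ g (x+1)) (b := x) (fun z hz => by omega) h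
  have h7 : m ≠ x := by rintro rfl; omega
  have h4 := h3 (m+1) (by omega)
  have h5 := hg m
  refine ⟨m, by omega, by omega, fun j hj hj2 => ?_⟩
  have := h3 j (by omega)
  omega

theorem status {g} (hg : US g) (x) : UR g x ∨ UL g x ∨ ∃ y, MM g x y := by
  rcases hg x with h | h
  · rcases up_cases hg h with h | ⟨y, h⟩
    · exact Or.inl h
    · exact Or.inr (Or.inr ⟨y, Or.inl h⟩)
  · rcases down_cases hg h with h | ⟨y, h⟩
    · exact Or.inr (Or.inl h)
    · exact Or.inr (Or.inr ⟨y, Or.inr h⟩)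

theorem UR_UL {g x} (h : UR g x) (h' : UL g x) : False := by
  have := h (x+1) (by omega); have := h' x le_rfl; omega

theorem UR_MM {g x y} (h : UR g x) (h' : MM g x y) : False := by
  rcases h' with ⟨h1, h2, h3⟩ | ⟨h1, h2, h3⟩
  · have := h (y+1) (by omega); omega
  · have := h (x+1) (by omega); have := h3 x (by omega) le_rfl; omega

theorem UL_MM {g x y} (h : UL g x) (h' : MM g x y) : False := by
  rcases h' with ⟨h1, h2, h3⟩ | ⟨h1, h2, h3⟩
  · have := h x le_rfl; have := h3 (x+1) (by omega) (by omega); omega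
  · have := h y (by omega); omega

theorem MM_uniq {g x y z} (h : MM g x y) (h' : MM g x z) : y = z := by
  rcases h with ⟨h1, h2, h3⟩ | ⟨h1, h2, h3⟩ <;> rcases h' with ⟨k1, k2, k3⟩ | ⟨k1, k2, k3⟩
  · by_contra hne
    rcases lt_or_gt_of_ne hne with h | h
    · have := k3 (y+1) (by omega) (by omega); omega
    · have := h3 (z+1) (by omega) (by omega); omega
  · have := h3 (x+1) (by omega) (by omega); have := k3 x (by omega) (by omega); omega
  · have := k3 (x+1) (by omega) (by omega); have := h3 x (by omega) (by omega); omega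
  · by_contra hne
    rcases lt_or_gt_of_ne hne with h | h
    · have := h3 z (by omega) (by omega); omega
    · have := k3 y (by omega) (by omega); omega

theorem MM_ne {g x y} (h : MM g x y) : x ≠ y := by
  rcases h with h | h <;> have := h.1 <;> omega

theorem Vis.refl (g i) : Vis g i i := ⟨rfl, fun k hk => by
  have : k = i := by omega
  rw [this]⟩
theorem Vis.symm {g i j} (h : Vis g i j) : Vis g j i :=
  ⟨h.1.symm, fun k hk => by have := h.2 k (by tauto); have := h.1; omega⟩
theorem Vis.trans {g i j k} (h : Vis g i j) (h' : Vis g j k) : Vis g i k := by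
  refine ⟨h.1.trans h'.1, fun l hl => ?_⟩
  have e := h.1
  have a1 := h.2 l
  have a2 := h'.2 l
  by_cases c : (i ≤ l ∧ l ≤ j ∨ j ≤ l ∧ l ≤ i)
  · exact a1 c
  · have := a2 (by omega); omega
theorem Vis.dip {g i j} (h : Vis g i j) (hd : Dip g i) : Dip g j := by
  obtain ⟨k, hk, hk2⟩ := hd
  have e := h.1
  have a := h.2 k
  refine ⟨k, ?_, by omega⟩
  by_contra hc
  have := a (by omega)
  omega

/-- the transition data for strands -/
structure TrM (g g' : ℤ → ℤ) (a : ℤ) : Prop where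
  t0 : MM g' (a-1) a
  t1 : ∀ x y, x ≠ a-1 → x ≠ a → y ≠ a-1 → y ≠ a → MM g x y → MM g' x y
  t2 : ∀ x y, x ≠ a-1 → x ≠ a → y ≠ a-1 → y ≠ a → MM g x (a-1) → MM g a y → MM g' x y
  t3 : ∀ x, x ≠ a-1 → x ≠ a → UR g x → UR g' x
  t3' : ∀ x, x ≠ a-1 → x ≠ a → UL g x → UL g' x
  t4 : ∀ x, x ≠ a-1 → x ≠ a → MM g x (a-1) → UR g a → UR g' x
  t4' : ∀ x, x ≠ a-1 → x ≠ a → MM g x (a-1) → UL g a → UL g' x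
  t5 : ∀ x, x ≠ a-1 → x ≠ a → MM g x a → UR g (a-1) → UR g' x
  t5' : ∀ x, x ≠ a-1 → x ≠ a → MM g x a → UL g (a-1) → UL g' x

structure TrV (V V' : ℤ → ℤ → Prop) (D D' : ℤ → Prop) (a b c : ℤ) : Prop where
  f1 : ∀ j, V' a j → j = a
  f1' : D' a
  f2 : ∀ i j, i ≠ a → j ≠ a → (V' i j ↔ V i j ∨ (V i b ∧ V c j) ∨ (V i c ∧ V b j))
  f3 : ∀ i, i ≠ a → (V i b ∨ V i c) → (D' i ↔ (D b ∧ D c))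
  f3' : ∀ i, i ≠ a → ¬ V i b → ¬ V i c → (D' i ↔ D i)
  f4 : ¬ V b c
  f5 : D b ∨ D c
  f6 : D a → ∃ i, i ≠ a ∧ V a i
  f7 : ¬ V a b
  f8 : ¬ V a c
  r : ∀ i, V i i
  s : ∀ i j, V i j → V j i
  t : ∀ i j k, V i j → V j k → V i k
  d : ∀ i j, V i j → D i → D j
  r' : ∀ i, V' i i
  s' : ∀ i j, V' i j → V' j i

def AA (V : ℤ → ℤ → Prop) (D : ℤ → Prop) (S : Set ℤ) : Prop :=
  ∀ i, (D i → ∃! s, s ∈ S ∧ V i s) ∧ (¬ D i → i ∉ S)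

def Stp1 (S T : Set ℤ) (a b : ℤ) : Prop :=
  a ∉ S ∧ b ∈ S ∧ ∀ j, j ∈ T ↔ (j = a ∨ (j ∈ S ∧ j ≠ b))

def Stp (S T : Set ℤ) (a : ℤ) : Prop := Stp1 S T a (a-1) ∨ Stp1 S T a (a+1)

theorem TrV.swap {V V' D D' a b c} (h : TrV V V' D D' a b c) : TrV V V' D D' a c b where
  f1 := h.f1
  f1' := h.f1'
  f2 := fun i j hi hj => by rw [h.f2 i j hi hj]; tauto
  f3 := fun i hi hv => by rw [h.f3 i hi hv.symm]; tauto
  f3' := fun i hi h1 h2 => h.f3' i hi h2 h1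
  f4 := fun hh => h.f4 (h.s _ _ hh)
  f5 := h.f5.symm
  f6 := h.f6
  f7 := h.f8
  f8 := h.f7
  r := h.r
  s := h.s
  t := h.t
  d := h.d
  r' := h.r'
  s' := h.s'

theorem TrV.fwd {V V' D D' a b c} (h : TrV V V' D D' a b c) {S T} (hS : AA V D S)
    (hst : Stp1 S T a b) : AA V' D' T := by
  obtain ⟨haS, hbS, hT⟩ := hst
  have hDb : D b := by by_contra hh; exact (hS b).2 hh hbS
  have hub : ∀ s ∈ S, V b s → s = b := fun s hs hv =>
    ((hS b).1 hDb).unique ⟨hs, hv⟩ ⟨hbS, h.r b⟩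
  intro i
  by_cases hia : i = a
  · subst hia
    exact ⟨fun _ => ⟨i, ⟨(hT i).2 (Or.inl rfl), h.r' i⟩, fun y hy => h.f1 y hy.2⟩,
      fun hn => absurd h.f1' hn⟩
  by_cases hm : V i b ∨ V i c
  · rw [h.f3 i hia hm]
    constructor
    · rintro ⟨_, hDc⟩
      obtain ⟨s, ⟨hs1, hs2⟩, hs3⟩ := (hS c).1 hDc
      have hsa : s ≠ a := by rintro rfl; exact haS hs1
      have hsb : s ≠ b := by rintro rfl; exact h.f4 (h.s _ _ hs2)
      refine ⟨s, ⟨(hT s).2 (Or.inr ⟨hs1, hsb⟩), ?_⟩, ?_⟩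
      · rw [h.f2 i s hia hsa]
        rcases hm with hm | hm
        · exact Or.inr (Or.inl ⟨hm, hs2⟩)
        · exact Or.inl (h.t _ _ _ hm hs2)
      · rintro t ⟨ht, hv⟩
        have hta : t ≠ a := by rintro rfl; exact hia (h.f1 _ (h.s' _ _ hv))
        rcases (hT t).1 ht with ht | ⟨ht, htb⟩
        · exact absurd ht hta
        have : V b t ∨ V c t := by
          rw [h.f2 i t hia hta] at hv
          rcases hv with hv | hv | hv
          · rcases hm with hm | hm
            · exact Or.inl (h.t _ _ _ (h.s _ _ hm) hv)
            · exact Or.inr (h.t _ _ _ (h.s _ _ hm) hv)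
          · exact Or.inr hv.2
          · exact Or.inl hv.2
        rcases this with hv | hv
        · exact absurd (hub t ht hv) htb
        · exact hs3 t ⟨ht, hv⟩
    · intro hn hi
      have hDc : ¬ D c := fun hc => hn ⟨hDb, hc⟩
      rcases (hT i).1 hi with hi | ⟨hi, hib⟩
      · exact hia hi
      rcases hm with hm | hm
      · exact hib (hub i hi (h.s _ _ hm))
      · exact (hS i).2 (fun hd => hDc (h.d _ _ hm hd)) hi
  · push Not at hm
    rw [h.f3' i hia hm.1 hm.2]
    have hv : ∀ j, j ≠ a → (V' i j ↔ V i j) := fun j hj => by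
      rw [h.f2 i j hia hj]; tauto
    constructor
    · intro hd
      obtain ⟨s, ⟨hs1, hs2⟩, hs3⟩ := (hS i).1 hd
      have hsa : s ≠ a := by rintro rfl; exact haS hs1
      have hsb : s ≠ b := by rintro rfl; exact hm.1 hs2
      refine ⟨s, ⟨(hT s).2 (Or.inr ⟨hs1, hsb⟩), (hv s hsa).2 hs2⟩, ?_⟩
      rintro t ⟨ht, hvt⟩
      have hta : t ≠ a := by rintro rfl; exact hia (h.f1 _ (h.s' _ _ hvt))
      rcases (hT t).1 ht with ht | ⟨ht, htb⟩
      · exact absurd ht hta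
      exact hs3 t ⟨ht, (hv t hta).1 hvt⟩
    · intro hd hi
      rcases (hT i).1 hi with hi | ⟨hi, hib⟩
      · exact hia hi
      exact (hS i).2 hd hi

theorem TrV.bwd1 {V V' D D' a b c} (h : TrV V V' D D' a b c) {T} (hT : AA V' D' T)
    (hDb : D b) (hb : ∀ t ∈ T, ¬ V b t) (hc : D c → ∃! t, t ∈ T ∧ V c t)
    (hc' : ¬ D c → ∀ t ∈ T, ¬ V c t) : ∃ S, AA V D S ∧ Stp1 S T a b := by
  have haT : a ∈ T := by
    obtain ⟨s, ⟨hs1, hs2⟩, _⟩ := (hT a).1 h.f1'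
    rwa [h.f1 s hs2] at hs1
  have hab : a ≠ b := by rintro rfl; exact h.f7 (h.r _)
  have hbT : b ∉ T := fun hh => hb b hh (h.r b)
  refine ⟨{j | j = b ∨ (j ∈ T ∧ j ≠ a)}, ?_, ?_, Or.inl rfl, ?_⟩
  · have key : ∀ i, i ≠ a → ¬ V i b → ¬ V i c → (D i → ∃! s, s ∈ {j | j = b ∨ (j ∈ T ∧ j ≠ a)} ∧ V i s) := by
      intro i hia h1 h2 hd
      have hv : ∀ j, j ≠ a → (V' i j ↔ V i j) := fun j hj => by
        rw [h.f2 i j hia hj]; tauto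
      obtain ⟨s, ⟨hs1, hs2⟩, hs3⟩ := (hT i).1 ((h.f3' i hia h1 h2).2 hd)
      have hsa : s ≠ a := by rintro rfl; exact hia (h.f1 _ (h.s' _ _ hs2))
      refine ⟨s, ⟨Or.inr ⟨hs1, hsa⟩, (hv s hsa).1 hs2⟩, ?_⟩
      rintro t ⟨rfl | ⟨ht, hta⟩, hvt⟩
      · exact absurd hvt h1
      · exact hs3 t ⟨ht, (hv t hta).2 hvt⟩
    intro i
    constructor
    · intro hd
      by_cases h1 : V i b
      · refine ⟨b, ⟨Or.inl rfl, h1⟩, ?_⟩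
        rintro t ⟨rfl | ⟨ht, hta⟩, hvt⟩
        · rfl
        · exact absurd (h.t _ _ _ (h.s _ _ h1) hvt) (hb t ht)
      by_cases h2 : V i c
      · obtain ⟨s, ⟨hs1, hs2⟩, hs3⟩ := hc (h.d _ _ h2 hd)
        have hsa : s ≠ a := by rintro rfl; exact h.f8 (h.s _ _ hs2)
        refine ⟨s, ⟨Or.inr ⟨hs1, hsa⟩, h.t _ _ _ h2 hs2⟩, ?_⟩
        rintro t ⟨rfl | ⟨ht, hta⟩, hvt⟩
        · exact absurd hvt h1
        · exact hs3 t ⟨ht, h.t _ _ _ (h.s _ _ h2) hvt⟩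
      by_cases hia : i = a
      · subst hia
        obtain ⟨i', hi', hv⟩ := h.f6 hd
        obtain ⟨s, ⟨hs1, hs2⟩, hs3⟩ := key i' hi' (fun hh => h1 (h.t _ _ _ hv hh))
          (fun hh => h2 (h.t _ _ _ hv hh)) (h.d _ _ hv hd)
        exact ⟨s, ⟨hs1, h.t _ _ _ hv hs2⟩, fun t ht => hs3 t ⟨ht.1, h.t _ _ _ (h.s _ _ hv) ht.2⟩⟩
      · exact key i hia h1 h2 hd
    · rintro hd (rfl | ⟨hi, hia⟩)
      · exact hd hDb
      · by_cases h1 : V i b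
        · exact hd (h.d _ _ (h.s _ _ h1) hDb)
        by_cases h2 : V i c
        · exact hc' (fun hh => hd (h.d _ _ (h.s _ _ h2) hh)) i hi (h.s _ _ h2)
        exact (hT i).2 (fun hh => hd ((h.f3' i hia h1 h2).1 hh)) hi
  · rintro (hh | hh)
    · exact hab hh
    · exact hh.2 rfl
  · intro j
    constructor
    · intro hj
      by_cases hja : j = a
      · exact Or.inl hja
      · exact Or.inr ⟨Or.inr ⟨hj, hja⟩, by rintro rfl; exact hbT hj⟩
    · rintro (rfl | ⟨rfl | hj, hjb⟩)
      · exact haT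
      · exact absurd rfl hjb
      · exact hj.1

theorem TrV.bwd {V V' D D' a b c} (h : TrV V V' D D' a b c) {T} (hT : AA V' D' T) :
    ∃ S, AA V D S ∧ (Stp1 S T a b ∨ Stp1 S T a c) := by
  have hba : b ≠ a := by rintro rfl; exact h.f7 (h.r _)
  have hca : c ≠ a := by rintro rfl; exact h.f8 (h.r _)
  have hbv : ∀ t, t ≠ a → (V' b t ↔ V b t ∨ V c t) := fun t ht => by
    rw [h.f2 b t hba ht]
    have := h.r b
    have := h.f4
    tauto
  have hnd : ¬ (D b ∧ D c) → ∀ t ∈ T, ¬ V b t ∧ ¬ V c t := by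
    intro hn t ht
    constructor <;> intro hv
    · have hta : t ≠ a := by rintro rfl; exact h.f7 (h.s _ _ hv)
      exact (hT t).2 (fun hd => hn ((h.f3 t hta (Or.inl (h.s _ _ hv))).1 hd)) ht
    · have hta : t ≠ a := by rintro rfl; exact h.f8 (h.s _ _ hv)
      exact (hT t).2 (fun hd => hn ((h.f3 t hta (Or.inr (h.s _ _ hv))).1 hd)) ht
  by_cases hDb : D b
  · by_cases hDc : D c
    · obtain ⟨s, ⟨hs1, hs2⟩, hs3⟩ := (hT b).1 ((h.f3 b hba (Or.inl (h.r b))).2 ⟨hDb, hDc⟩)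
      have hsa : s ≠ a := by rintro rfl; exact hba (h.f1 _ (h.s' _ _ hs2))
      have hu : ∀ t ∈ T, V b t ∨ V c t → t = s := fun t ht hv => by
        have hta : t ≠ a := by
          rintro rfl
          rcases hv with hv | hv
          · exact h.f7 (h.s _ _ hv)
          · exact h.f8 (h.s _ _ hv)
        exact hs3 t ⟨ht, (hbv t hta).2 hv⟩
      rcases (hbv s hsa).1 hs2 with hv | hv
      · obtain ⟨S, h1, h2⟩ := h.swap.bwd1 hT hDc (fun t ht hct => by
          have := hu t ht (Or.inr hct); subst this
          exact h.f4 (h.t _ _ _ hv (h.s _ _ hct)))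
          (fun _ => ⟨s, ⟨hs1, hv⟩, fun t ht => hu t ht.1 (Or.inl ht.2)⟩)
          (fun hh => absurd hDb hh)
        exact ⟨S, h1, Or.inr h2⟩
      · obtain ⟨S, h1, h2⟩ := h.bwd1 hT hDb (fun t ht hct => by
          have := hu t ht (Or.inl hct); subst this
          exact h.f4 (h.t _ _ _ hct (h.s _ _ hv)))
          (fun _ => ⟨s, ⟨hs1, hv⟩, fun t ht => hu t ht.1 (Or.inr ht.2)⟩)
          (fun hh => absurd hDc hh)
        exact ⟨S, h1, Or.inl h2⟩
    · have := hnd (fun hh => hDc hh.2)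
      obtain ⟨S, h1, h2⟩ := h.bwd1 hT hDb (fun t ht => (this t ht).1)
        (fun hh => absurd hh hDc) (fun _ t ht => (this t ht).2)
      exact ⟨S, h1, Or.inl h2⟩
  · have hDc : D c := h.f5.resolve_left hDb
    have := hnd (fun hh => hDb hh.1)
    obtain ⟨S, h1, h2⟩ := h.swap.bwd1 hT hDc (fun t ht => (this t ht).2)
        (fun hh => absurd hh hDb) (fun _ t ht => (this t ht).1)
    exact ⟨S, h1, Or.inr h2⟩

def TrA (g g' : ℤ → ℤ) (a : ℤ) : Prop := TrV (Vis g) (Vis g') (Dip g) (Dip g') a (a-1) (a+1)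

abbrev AG (g : ℤ → ℤ) := AA (Vis g) (Dip g)

theorem TrA.iff {g g' a} (h : TrA g g' a) (T : Set ℤ) :
    AG g' T ↔ ∃ S, AG g S ∧ Stp S T a := by
  constructor
  · exact fun hT => TrV.bwd h hT
  · rintro ⟨S, hS, h1 | h1⟩
    · exact TrV.fwd h hS h1
    · exact TrV.fwd (TrV.swap h) hS h1


theorem trM_V {g g' : ℤ → ℤ} {a : ℤ} (h1 : g (a-1) = g a + 1) (h2 : g (a+1) = g a + 1)
    (e1 : g' a = g a + 2) (e2 : ∀ j, j ≠ a → g' j = g j) : TrM g g' a := by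
  have ea : a - 1 + 1 = a := by omega
  constructor
  · left; refine ⟨by omega, ?_, fun j hj1 hj2 => ?_⟩
    · rw [e2 _ (by omega), e2 _ (by omega)]; omega
    · have : j = a := by omega
      subst this; rw [e2 _ (by omega)]; omega
  · simp only [MM, Mt]; grind
  · simp only [MM, Mt]; grind
  · simp only [UR]; grind
  · simp only [UL]; grind
  · simp only [UR, MM, Mt]; grind
  · simp only [UL, MM, Mt]; grind
  · simp only [UR, MM, Mt]; grind
  · simp only [UL, MM, Mt]; grind

theorem trM_U {g g' : ℤ → ℤ} {a y : ℤ} (hg : US g) (h1 : g (a-1) = g a - 1) (h2 : g (a+1) = g a + 1)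
    (hy : Mt g a y)
    (e1 : ∀ j, a < j → j ≤ y → g' j = g j - 2) (e2 : ∀ j, j ≤ a → g' j = g j)
    (e3 : ∀ j, y < j → g' j = g j) : TrM g g' a := by
  have ea : a - 1 + 1 = a := by omega
  have hyM : MM g a y := Or.inl hy
  obtain ⟨y1, y2, y3⟩ := hy
  have hy1 : g y = g a + 1 := by
    have := hg y; have := y3 y y1 le_rfl; omega
  constructor
  · simp only [MM, Mt]; grind
  · simp only [MM, Mt]; grind
  · intro x z _ _ _ _ hx hz
    have := MM_uniq hyM hz
    subst this
    revert hx
    simp only [MM, Mt]; grind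
  · simp only [UR]; grind
  · simp only [UL]; grind
  · simp only [UR, MM, Mt]; grind
  · simp only [UL, MM, Mt]; grind
  · intro x _ _ hx hz
    have := MM_uniq hyM hx.symm
    subst this
    revert hz
    simp only [UR]; grind
  · simp only [UL, MM, Mt]; grind

theorem trM_D {g g' : ℤ → ℤ} {a y : ℤ} (hg : US g) (h1 : g (a-1) = g a + 1) (h2 : g (a+1) = g a - 1)
    (hy : Mt g y (a-1))
    (e1 : ∀ j, y < j → j < a → g' j = g j - 2) (e2 : ∀ j, j ≤ y → g' j = g j)
    (e3 : ∀ j, a ≤ j → g' j = g j) : TrM g g' a := by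
  have ea : a - 1 + 1 = a := by omega
  have hyM : MM g (a-1) y := Or.inr hy
  obtain ⟨y1, y2, y3⟩ := hy
  have hy1 : g (y+1) = g a + 1 := by
    have := hg y; have := y3 (y+1) (by omega) (by omega); grind
  constructor
  · simp only [MM, Mt]; grind
  · simp only [MM, Mt]; grind
  · intro x z _ _ _ _ hx hz
    have := MM_uniq hyM hx.symm
    subst this
    revert hz
    simp only [MM, Mt]; grind
  · simp only [UR]; grind
  · simp only [UL]; grind
  · simp only [UR, MM, Mt]; grind
  · intro x _ _ hx hz
    have := MM_uniq hyM hx.symm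
    subst this
    revert hz
    simp only [UL]; grind
  · simp only [UR, MM, Mt]; grind
  · simp only [UL, MM, Mt]; grind


theorem vis_le {g i j} (h : i ≤ j) :
    Vis g i j ↔ (g i = g j ∧ ∀ k, i ≤ k → k ≤ j → g i ≤ g k) := by
  constructor
  · rintro ⟨h1, h2⟩; exact ⟨h1, fun k hk hk2 => h2 k (Or.inl ⟨hk, hk2⟩)⟩
  · rintro ⟨h1, h2⟩
    refine ⟨h1, fun k hk => ?_⟩
    apply h2 <;> omega

theorem Vis.comm' {g i j} : Vis g i j ↔ Vis g j i := ⟨Vis.symm, Vis.symm⟩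

theorem f2_wlog {g g' : ℤ → ℤ} {a b c : ℤ}
    (h : ∀ i j, i < j → i ≠ a → j ≠ a →
      (Vis g' i j ↔ Vis g i j ∨ (Vis g i b ∧ Vis g c j) ∨ (Vis g i c ∧ Vis g b j))) :
    ∀ i j, i ≠ a → j ≠ a →
      (Vis g' i j ↔ Vis g i j ∨ (Vis g i b ∧ Vis g c j) ∨ (Vis g i c ∧ Vis g b j)) := by
  intro i j hi hj
  rcases lt_trichotomy i j with hlt | rfl | hlt
  · exact h i j hlt hi hj
  · exact ⟨fun _ => Or.inl (Vis.refl _ _), fun _ => Vis.refl _ _⟩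
  · have e := h j i hlt hj hi
    constructor
    · intro hv
      rcases e.1 hv.symm with h1 | h1 | h1
      · exact Or.inl h1.symm
      · exact Or.inr (Or.inr ⟨h1.2.symm, h1.1.symm⟩)
      · exact Or.inr (Or.inl ⟨h1.2.symm, h1.1.symm⟩)
    · intro hv
      apply Vis.symm
      apply e.2
      rcases hv with h1 | h1 | h1
      · exact Or.inl h1.symm
      · exact Or.inr (Or.inr ⟨h1.2.symm, h1.1.symm⟩)
      · exact Or.inr (Or.inl ⟨h1.2.symm, h1.1.symm⟩)

theorem trA_V {g g' : ℤ → ℤ} {a : ℤ} (hg : US g) (h1 : g (a-1) = g a + 1) (h2 : g (a+1) = g a + 1)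
    (e1 : g' a = g a + 2) (e2 : ∀ j, j ≠ a → g' j = g j) 
    : TrA g g' a := by
  refine ⟨?_, ?_, ?_, ?_, ?_, ?_, ?_, ?_, ?_, ?_, Vis.refl g, fun _ _ => Vis.symm,
    fun _ _ _ => Vis.trans, fun _ _ => Vis.dip, Vis.refl g', fun _ _ => Vis.symm⟩
  · simp only [Vis]; grind
  · exact ⟨a+1, by omega, by rw [e2 _ (by omega)]; omega⟩
  · apply f2_wlog
    intro i j hij hi hj
    constructor
    · intro hv
      rw [vis_le hij.le] at hv
      by_cases c : i < a ∧ a < j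
      · by_cases c2 : g i ≤ g a
        · left; rw [vis_le hij.le]; grind
        · right; left
          rw [vis_le (by omega), vis_le (by omega)]
          grind
      · left; rw [vis_le hij.le]; grind
    · rintro (hv | ⟨hv, hw⟩ | ⟨hv, hw⟩)
      · rw [vis_le hij.le] at hv ⊢; grind
      · rw [vis_le hij.le]
        simp only [Vis] at hv hw
        grind
      · simp only [Vis] at hv hw
        grind
  · simp only [Vis, Dip]; grind
  · simp only [Vis, Dip]; grind
  · simp only [Vis]; grind
  · left; exact ⟨a, by omega, by omega⟩
  · rintro ⟨k, hk, hk2⟩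
    rcases up_cases hg h2 with h | ⟨y, h, h', h''⟩
    · have := h k hk; omega
    · refine ⟨y+1, by omega, ?_⟩
      rw [vis_le (by omega)]
      grind
  · simp only [Vis]; grind
  · simp only [Vis]; grind

theorem trA_U {g g' : ℤ → ℤ} {a y : ℤ} (hg : US g) (h1 : g (a-1) = g a - 1) (h2 : g (a+1) = g a + 1)
    (hy : Mt g a y)
    (e1 : ∀ j, a < j → j ≤ y → g' j = g j - 2) (e2 : ∀ j, j ≤ a → g' j = g j)
    (e3 : ∀ j, y < j → g' j = g j) : TrA g g' a := by
  obtain ⟨y1, y2, y3⟩ := hy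
  have hy1 : g y = g a + 1 := by
    have := hg y; have := y3 y y1 le_rfl; omega
  refine ⟨?_, ?_, ?_, ?_, ?_, ?_, ?_, ?_, ?_, ?_, Vis.refl g, fun _ _ => Vis.symm,
    fun _ _ _ => Vis.trans, fun _ _ => Vis.dip, Vis.refl g', fun _ _ => Vis.symm⟩
  · simp only [Vis]; grind
  · simp only [Dip]; grind
  · apply f2_wlog
    intro i j hij hi hj
    constructor
    · intro hv
      rw [vis_le hij.le] at hv
      by_cases c : i < a ∧ a < j ∧ j ≤ y
      · right; left
        rw [vis_le (by omega), vis_le (by omega)]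
        grind
      by_cases c' : a < i ∧ i ≤ y ∧ y < j
      · have := hv.2 y (by omega) (by omega)
        right; right
        rw [Vis.comm', vis_le (by omega), vis_le (by omega)]
        grind
      · left; rw [vis_le hij.le]; grind
    · rintro (hv | ⟨hv, hw⟩ | ⟨hv, hw⟩)
      · rw [vis_le hij.le] at hv ⊢; grind
      · rw [vis_le hij.le]
        simp only [Vis] at hv hw
        grind
      · rw [vis_le hij.le]
        simp only [Vis] at hv hw
        grind
  · simp only [Vis, Dip]; grind
  · intro i hia n1 n2
    constructor
    · rintro ⟨k, hk, hk2⟩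
      by_cases c : i < a
      · by_cases c2 : g i < g a
        · exact ⟨k, hk, by grind⟩
        · exact ⟨a-1, by grind, by grind⟩
      · exact ⟨k, hk, by grind⟩
    · rintro ⟨k, hk, hk2⟩
      by_cases c : a < i ∧ i ≤ y
      · have : g i ≠ g a + 1 := by
          intro hh
          apply n2
          apply Vis.symm
          rw [vis_le (by omega)]
          grind
        exact ⟨y, by grind, by grind⟩
      · exact ⟨k, hk, by grind⟩
  · simp only [Vis]; grind
  · simp only [Dip]; grind
  · simp only [Dip, Vis]; grind
  · simp only [Vis]; grind
  · simp only [Vis]; grind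

theorem trA_D {g g' : ℤ → ℤ} {a y : ℤ} (hg : US g) (h1 : g (a-1) = g a + 1) (h2 : g (a+1) = g a - 1)
    (hy : Mt g y (a-1))
    (e1 : ∀ j, y < j → j < a → g' j = g j - 2) (e2 : ∀ j, j ≤ y → g' j = g j)
    (e3 : ∀ j, a ≤ j → g' j = g j) : TrA g g' a := by
  obtain ⟨y1, y2, y3⟩ := hy
  have ea : a - 1 + 1 = a := by omega
  rw [ea] at y2
  have hy1 : g (y+1) = g a + 1 := by
    have := hg y; have := y3 (y+1) (by omega) (by omega); grind
  refine ⟨?_, ?_, ?_, ?_, ?_, ?_, ?_, ?_, ?_, ?_, Vis.refl g, fun _ _ => Vis.symm,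
    fun _ _ _ => Vis.trans, fun _ _ => Vis.dip, Vis.refl g', fun _ _ => Vis.symm⟩
  · simp only [Vis]; grind
  · simp only [Dip]; grind
  · apply f2_wlog
    intro i j hij hi hj
    constructor
    · intro hv
      rw [vis_le hij.le] at hv
      by_cases c : y < i ∧ i < a ∧ a < j
      · right; left
        rw [vis_le (by omega), vis_le (by omega)]
        grind
      by_cases c' : i ≤ y ∧ y < j ∧ j < a
      · have := hv.2 (y+1) (by omega) (by omega)
        right; right
        rw [vis_le (by omega), Vis.comm' (i := a-1), vis_le (by omega)]
        grind
      · left; rw [vis_le hij.le]; grind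
    · rintro (hv | ⟨hv, hw⟩ | ⟨hv, hw⟩)
      · rw [vis_le hij.le] at hv ⊢; grind
      · rw [vis_le hij.le]
        simp only [Vis] at hv hw
        grind
      · rw [vis_le hij.le]
        simp only [Vis] at hv hw
        grind
  · simp only [Vis, Dip]; grind
  · simp only [Vis, Dip]; grind
  · simp only [Vis]; grind
  · simp only [Dip]; grind
  · simp only [Dip, Vis]; grind
  · simp only [Vis]; grind
  · simp only [Vis]; grind

def Good (g : ℤ → ℤ) : Prop := US g ∧ ∃ N : ℤ, 0 ≤ N ∧ ∀ j, (N ≤ j ∨ j ≤ -N) → g j = |j|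

def Alive (g : ℤ → ℤ) (a : ℤ) : Prop :=
  ¬ MM g (a-1) a ∧ ¬ (UR g (a-1) ∧ UR g a) ∧ ¬ (UL g (a-1) ∧ UL g a)

theorem step_alive {g a} (hG : Good g) (ha : Alive g a) :
    ∃ g', Good g' ∧ TrM g g' a ∧ TrA g g' a := by
  obtain ⟨hg, N, hN0, hN⟩ := hG
  obtain ⟨A1, A2, A3⟩ := ha
  have ea : a - 1 + 1 = a := by omega
  have s1 := hg (a-1)
  rw [ea] at s1
  rcases s1 with s1 | s1 <;> rcases hg a with s2 | s2
  · have : ¬ UR g a := by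
      intro h
      refine A2 ⟨fun j hj => ?_, h⟩
      by_cases c : j = a
      · subst c; omega
      · have := h j (by omega); omega
    obtain ⟨y, hy⟩ := (up_cases hg s2).resolve_left this
    have e1 : ∀ j, a < j → j ≤ y → (fun j => if a < j ∧ j ≤ y then g j - 2 else g j) j = g j - 2 := by
      intro j h1 h2; simp [h1, h2]
    have e2 : ∀ j, j ≤ a → (fun j => if a < j ∧ j ≤ y then g j - 2 else g j) j = g j := by
      intro j h1; simp only; rw [if_neg]; omega
    have e3 : ∀ j, y < j → (fun j => if a < j ∧ j ≤ y then g j - 2 else g j) j = g j := by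
      intro j h1; simp only; rw [if_neg]; omega
    refine ⟨_, ⟨?_, N + |a| + |y|+1, by positivity, ?_⟩,
      trM_U hg (by omega) s2 hy e1 e2 e3, trA_U hg (by omega) s2 hy e1 e2 e3⟩
    · obtain ⟨y1, y2, y3⟩ := hy
      have hy1 : g y = g a + 1 := by
        have := hg y; have := y3 y y1 le_rfl; omega
      intro j
      have := hg j
      grind
    · intro j hj
      have b1 := le_abs_self a
      have b2 := neg_abs_le a
      have b3 := le_abs_self y
      have b4 := neg_abs_le y
      rw [if_neg (by omega)]
      apply hN; omega
  · exact absurd (Or.inl ⟨by omega, by omega, fun j h1 h2 => by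
      have : j = a := by omega
      subst this; omega⟩) A1
  · have e1 : (fun j => if j = a then g a + 2 else g j) a = g a + 2 := by simp
    have e2 : ∀ j, j ≠ a → (fun j => if j = a then g a + 2 else g j) j = g j := by
      intro j hj; simp [hj]
    refine ⟨_, ⟨?_, N + |a|+1, by positivity, ?_⟩,
      trM_V (by omega) s2 e1 e2, trA_V hg (by omega) s2 e1 e2⟩
    · intro j
      have := hg j
      grind
    · intro j hj
      have b1 := le_abs_self a
      have b2 := neg_abs_le a
      have b3 := le_abs_self a
      have b4 := neg_abs_le a
      rw [if_neg (by omega)]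
      apply hN; omega
  · have : ¬ UL g (a-1) := by
      intro h
      refine A3 ⟨h, fun j hj => ?_⟩
      by_cases c : j = a
      · subst c; omega
      · have := h j (by omega); rw [ea] at this; omega
    obtain ⟨y, hy⟩ := (down_cases hg (by rw [ea]; omega)).resolve_left this
    have e1 : ∀ j, y < j → j < a → (fun j => if y < j ∧ j < a then g j - 2 else g j) j = g j - 2 := by
      intro j h1 h2; simp [h1, h2]
    have e2 : ∀ j, j ≤ y → (fun j => if y < j ∧ j < a then g j - 2 else g j) j = g j := by
      intro j h1; simp only; rw [if_neg]; omega
    have e3 : ∀ j, a ≤ j → (fun j => if y < j ∧ j < a then g j - 2 else g j) j = g j := by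
      intro j h1; simp only; rw [if_neg]; omega
    refine ⟨_, ⟨?_, N + |a| + |y|+1, by positivity, ?_⟩,
      trM_D hg (by omega) s2 hy e1 e2 e3, trA_D hg (by omega) s2 hy e1 e2 e3⟩
    · obtain ⟨y1, y2, y3⟩ := hy
      have hy1 : g (y+1) = g a + 1 := by
        have := hg y; have := y3 (y+1) (by omega) (by omega); grind
      rw [ea] at y2
      intro j
      have := hg j
      grind
    · intro j hj
      have b1 := le_abs_self a
      have b2 := neg_abs_le a
      have b3 := le_abs_self y
      have b4 := neg_abs_le y
      rw [if_neg (by omega)]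
      apply hN; omega

theorem step_dead {g a} (hg : US g) (ha : ¬ Alive g a) {S T} (hS : AG g S) (h : Stp S T a) :
    False := by
  have ea : a - 1 + 1 = a := by omega
  have haS : a ∉ S := by rcases h with h | h <;> exact h.1
  have key : Dip g a → (∀ s, Vis g a s → s = a) → False := by
    intro h1 h2
    obtain ⟨s, ⟨hs1, hs2⟩, _⟩ := (hS a).1 h1
    rw [h2 s hs2] at hs1
    exact haS hs1
  simp only [Alive] at ha
  by_cases c1 : MM g (a-1) a
  · rcases c1 with ⟨h1, h2, h3⟩ | ⟨h1, _⟩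
    · have h4 := h3 a (by omega) le_rfl
      refine key ⟨a+1, by omega, by omega⟩ (fun s hs => ?_)
      simp only [Vis] at hs
      grind
    · omega
  by_cases c2 : UR g (a-1) ∧ UR g a
  · obtain ⟨u1, u2⟩ := c2
    rcases h with h | h
    · refine (hS (a-1)).2 ?_ h.2.1
      rintro ⟨k, hk, hk2⟩
      have := u1 k hk; omega
    · refine (hS (a+1)).2 ?_ h.2.1
      rintro ⟨k, hk, hk2⟩
      have := u2 k (by omega); have := hg a; omega
  by_cases c3 : UL g (a-1) ∧ UL g a
  · obtain ⟨u1, u2⟩ := c3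
    have u3 := u2 a le_rfl
    refine key ⟨a+1, by omega, by omega⟩ (fun s hs => ?_)
    simp only [Vis] at hs
    simp only [UL] at u1 
    rw [ea] at u1
    grind
  · tauto

theorem good0 : Good (fun j => |j|) := by
  refine ⟨fun j => ?_, 0, le_rfl, fun _ _ => rfl⟩
  simp only; grind

theorem mm0 {x y} (h : MM (fun j => |j|) x y) : False := by
  have key : ∀ x y, Mt (fun j => |j|) x y → False := by
    rintro x y ⟨h1, h2, h3⟩
    simp only at h2 h3
    have := h3 (x+1) (by omega) (by omega)
    grind
  rcases h with h | h <;> exact key _ _ h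

theorem ag0 {S : Set ℤ} : AG (fun j => |j|) S ↔ S = {j | j < 0} := by
  have hd : ∀ i : ℤ, Dip (fun j => |j|) i ↔ i < 0 := by
    intro i
    constructor
    · rintro ⟨k, h1, h2⟩; simp only at h2; grind
    · intro h; exact ⟨0, h, by simp only; grind⟩
  have hv : ∀ i j : ℤ, Vis (fun j => |j|) i j ↔ j = i := by
    intro i j
    constructor
    · rintro ⟨h1, h2⟩; simp only at h1 h2
      have := h2 0
      rw [abs_zero] at this
      rcases abs_cases i with c1 | c1 <;> rcases abs_cases j with c2 | c2 <;> omega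
    · rintro rfl; exact Vis.refl _ _
  constructor
  · intro h
    ext i
    constructor
    · intro hi
      by_contra hc
      exact (h i).2 (by rw [hd]; exact hc) hi
    · intro hi
      obtain ⟨s, ⟨h1, h2⟩, _⟩ := (h i).1 ((hd i).2 hi)
      rwa [(hv i s).1 h2] at h1
  · rintro rfl i
    constructor
    · intro hi
      exact ⟨i, ⟨(hd i).1 hi, Vis.refl _ _⟩, fun s hs => (hv i s).1 hs.2⟩
    · intro hi; exact fun hh => hi ((hd i).2 hh)

theorem agfin1 {g} (hg : US g) (h : AG g {j | j < 0}) {x y} (hm : Mt g x y) : x ≤ -2 ∧ -1 ≤ y := by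
  obtain ⟨h1, h2, h3⟩ := hm
  have g1 : g (x+1) = g x + 1 := by
    have := hg x; have := h3 (x+1) (by omega) (by omega); omega
  have g2 : g y = g x + 1 := by
    have := hg y; have := h3 y (by omega) (by omega); omega
  have v1 : Vis g (x+1) y := by rw [vis_le (by omega)]; grind
  have v2 : Vis g x (y+1) := by rw [vis_le (by omega)]; grind
  have d1 : Dip g (x+1) := ⟨y+1, by omega, by omega⟩
  constructor
  · obtain ⟨s, ⟨hs1, hs2⟩, hs3⟩ := (h (x+1)).1 d1
    simp only [Set.mem_ofPred_eq] at hs1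
    by_contra hc
    have := hs2.2 x (by omega)
    omega
  · by_contra hc
    have d2 : Dip g x := by
      by_contra hd
      exact (h x).2 hd (by simp only [Set.mem_ofPred_eq]; omega)
    have := ((h x).1 d2).unique (y₁ := x) (y₂ := y+1) ⟨by simp only [Set.mem_ofPred_eq]; omega, Vis.refl _ _⟩
      ⟨by simp only [Set.mem_ofPred_eq]; omega, v2⟩
    omega

theorem agfin2 {g} (hG : Good g) (h : ∀ x y, Mt g x y → x ≤ -2 ∧ -1 ≤ y) : AG g {j | j < 0} := by
  obtain ⟨hg, N, hN0, hN⟩ := hG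
  have peak : ∀ i, i ≠ -1 → g i = g (i-1) + 1 → g (i+1) = g i + 1 := by
    intro i hi h1
    by_contra hc
    have := hg i
    have := h (i-1) i ⟨by omega, by omega, fun j hj hj2 => by
      have : j = i := by omega
      subst this; omega⟩
    omega
  obtain ⟨v, ⟨hv1, hv2⟩, hv3⟩ := exists_greatest (P := fun v => v ≤ -1 ∧ ∀ j, j ≤ v → g j = -j) (b := -1)
    (fun z hz => hz.1) ⟨-N-1, by omega, fun j hj => by rw [hN j (by omega)]; grind⟩
  have up : ∀ n : ℕ, v + n ≤ -1 → g (v+n) = -v + n ∧ (v + n + 1 ≤ -1 → g (v+n+1) = -v+n+1) := by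
    intro n
    induction n with
    | zero =>
      intro _
      have := hv2 v le_rfl
      refine ⟨by simpa using this, fun h1 => ?_⟩
      have h4 := hv3 (v+1) (by omega)
      simp only [Nat.cast_zero, add_zero] at *
      rcases hg v with h5 | h5
      · omega
      · exfalso
        apply h4
        refine ⟨by omega, fun j hj => ?_⟩
        by_cases c : j = v+1
        · subst c; omega
        · exact hv2 j (by omega)
    | succ n ih =>
      intro h1
      push_cast at *
      obtain ⟨i1, i2⟩ := ih (by omega)
      have i3 := i2 (by omega)
      have e : v + n + 1 = v + (n + 1) := by ring
      rw [e] at i3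
      refine ⟨by omega, fun h2 => ?_⟩
      have := peak (v + (n+1)) (by omega) (by
        have : v + (n+1) - 1 = v + (n:ℤ) := by ring
        rw [this]; omega)
      omega
  have left : ∀ j, v ≤ j → j ≤ -1 → g j = j - 2 * v := by
    intro j h1 h2
    have := (up (j-v).toNat (by omega)).1
    have e : v + ((j-v).toNat : ℤ) = j := by omega
    rw [e] at this; omega
  obtain ⟨w, ⟨hw1, hw2⟩, hw3⟩ := exists_least (P := fun v => -1 ≤ v ∧ ∀ j, v ≤ j → g j = j) (b := -1)
    (fun z hz => hz.1) ⟨N, by omega, fun j hj => by rw [hN j (by omega)]; grind⟩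
  have dn : ∀ n : ℕ, -1 ≤ w - n → g (w-n) = w + n ∧ (-1 ≤ w - n - 1 → g (w-n-1) = w+n+1) := by
    intro n
    induction n with
    | zero =>
      intro _
      have := hw2 w le_rfl
      refine ⟨by simpa using this, fun h1 => ?_⟩
      have h4 := hw3 (w-1) (by omega)
      simp only [Nat.cast_zero, sub_zero, add_zero] at *
      have h5 := hg (w-1)
      have e : w - 1 + 1 = w := by ring
      rw [e] at h5
      rcases h5 with h5 | h5
      · exfalso
        apply h4
        refine ⟨by omega, fun j hj => ?_⟩
        by_cases c : j = w-1
        · subst c; omega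
        · exact hw2 j (by omega)
      · omega
    | succ n ih =>
      intro h1
      push_cast at *
      obtain ⟨i1, i2⟩ := ih (by omega)
      have i3 := i2 (by omega)
      have e : w - n - 1 = w - (n + 1) := by ring
      rw [e] at i3
      refine ⟨by omega, fun h2 => ?_⟩
      have p := peak (w - (n+1)) (by omega)
      have e2 : w - (n+1) + 1 = w - (n:ℤ) := by ring
      rw [e2] at p
      have q := hg (w - (n+1) - 1)
      have e3 : w - (n+1:ℤ) - 1 + 1 = w - (n+1) := by ring
      rw [e3] at q
      omega
  have right : ∀ j, -1 ≤ j → j ≤ w → g j = 2 * w - j := by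
    intro j h1 h2
    have := (dn (w-j).toNat (by omega)).1
    have e : w - ((w-j).toNat : ℤ) = j := by omega
    rw [e] at this; omega
  have hvw : w = -v - 1 := by
    have := left (-1) (by omega) le_rfl
    have := right (-1) le_rfl (by omega)
    omega
  have gval : ∀ j, (j ≤ v ∧ g j = -j) ∨ (v ≤ j ∧ j ≤ -1 ∧ g j = j - 2*v) ∨
      (-1 ≤ j ∧ j ≤ w ∧ g j = 2*w - j) ∨ (w ≤ j ∧ g j = j) := by
    intro j
    by_cases c1 : j ≤ v
    · exact Or.inl ⟨c1, hv2 j c1⟩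
    by_cases c2 : j ≤ -1
    · exact Or.inr (Or.inl ⟨by omega, c2, left j (by omega) c2⟩)
    by_cases c3 : j ≤ w
    · exact Or.inr (Or.inr (Or.inl ⟨by omega, c3, right j (by omega) c3⟩))
    · exact Or.inr (Or.inr (Or.inr ⟨by omega, hw2 j (by omega)⟩))
  have uniq : ∀ s t, s < 0 → t < 0 → s < t → Vis g s t → False := by
    intro s t hs ht hst hV
    have a1 := hV.1
    have a2 := hV.2 v
    have b1 := gval s
    have b2 := gval t
    have b3 := gval v
    omega
  have ex : ∀ i, Dip g i → ∃ s, s < 0 ∧ Vis g i s := by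
    rintro i ⟨k, hk1, hk2⟩
    by_cases c : i < 0
    · exact ⟨i, c, Vis.refl _ _⟩
    · have b1 := gval i
      have b2 := gval k
      refine ⟨-2-i, by omega, Vis.symm ?_⟩
      rw [vis_le (by omega)]
      have b3 := gval (-2-i)
      refine ⟨by omega, fun l h1 h2 => ?_⟩
      have b4 := gval l
      omega
  intro i
  constructor
  · intro hd
    obtain ⟨s, hs, hV⟩ := ex i hd
    refine ⟨s, ⟨hs, hV⟩, ?_⟩
    rintro t ⟨ht, hV'⟩
    simp only [Set.mem_ofPred_eq] at ht
    rcases lt_trichotomy s t with h1 | h1 | h1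
    · exact (uniq s t hs ht h1 (hV.symm.trans hV')).elim
    · exact h1.symm
    · exact (uniq t s ht hs h1 (hV'.symm.trans hV)).elim
  · intro hd hi
    simp only [Set.mem_ofPred_eq] at hi
    apply hd
    have b1 := gval i
    have b2 := gval w
    refine ⟨w, by omega, by omega⟩


def Lay (n : ℕ) (a : ℤ) (v u : ℤ × ℕ) : Prop :=
  (v.1 ≠ a - 1 ∧ v.1 ≠ a ∧ u.1 = v.1 ∧ v.2 = n ∧ u.2 = n + 1) ∨
  (v = (a - 1, n) ∧ u = (a, n)) ∨ (v = (a - 1, n + 1) ∧ u = (a, n + 1))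

def IAdj (il : List ℤ) (v u : ℤ × ℕ) : Prop := ∃ (m : ℕ) (a : ℤ), il[m]? = some a ∧ Lay m a v u

def RR (il : List ℤ) : ℤ × ℕ → ℤ × ℕ → Prop :=
  Relation.ReflTransGen (fun v u => IAdj il v u ∨ IAdj il u v)

theorem RR.refl (il v) : RR il v v := Relation.ReflTransGen.refl
theorem RR.trans {il v u z} (h : RR il v u) (h' : RR il u z) : RR il v z :=
  Relation.ReflTransGen.trans h h'
theorem RR.symm {il v u} (h : RR il v u) : RR il u v := by
  induction h with
  | refl => exact Relation.ReflTransGen.refl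
  | tail _ h ih => exact Relation.ReflTransGen.head (Or.symm h) ih
theorem RR.of {il v u} (h : IAdj il v u) : RR il v u := Relation.ReflTransGen.single (Or.inl h)

theorem IAdj.level {il v u} (h : IAdj il v u) : v.2 ≤ il.length ∧ u.2 ≤ il.length := by
  obtain ⟨m, a, h1, h2⟩ := h
  have hm : m < il.length := (List.getElem?_eq_some_iff.1 h1).1
  rcases h2 with h2 | ⟨rfl, rfl⟩ | ⟨rfl, rfl⟩
  · omega
  · simp only; omega
  · simp only; omega

theorem RR.level {il v u} (h : RR il v u) : u = v ∨ u.2 ≤ il.length := by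
  induction h with
  | refl => exact Or.inl rfl
  | tail _ h _ =>
    right
    rcases h with h | h
    · exact h.level.2
    · exact h.level.1

theorem iadj_append {w : List ℤ} {a : ℤ} {v u} :
    IAdj (w ++ [a]) v u ↔ IAdj w v u ∨ Lay w.length a v u := by
  constructor
  · rintro ⟨m, b, h1, h2⟩
    rw [List.getElem?_append] at h1
    split_ifs at h1 with hm
    · exact Or.inl ⟨m, b, h1, h2⟩
    · right
      obtain ⟨h3, h4⟩ := List.getElem?_eq_some_iff.1 h1
      simp only [List.length_singleton, List.getElem_singleton] at h3 h4
      have : m = w.length := by omega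
      subst this; subst h4; exact h2
  · rintro (⟨m, b, h1, h2⟩ | h)
    · have hm : m < w.length := (List.getElem?_eq_some_iff.1 h1).1
      exact ⟨m, b, by rw [List.getElem?_append_left hm]; exact h1, h2⟩
    · exact ⟨w.length, a, by simp, h⟩

theorem RR.mono {w : List ℤ} {a : ℤ} {v u} (h : RR w v u) : RR (w ++ [a]) v u := by
  refine Relation.ReflTransGen.mono (fun x y hxy => ?_) _ _ h
  rcases hxy with h | h
  · exact Or.inl (iadj_append.2 (Or.inl h))
  · exact Or.inr (iadj_append.2 (Or.inl h))

theorem RR.lay {w : List ℤ} {a : ℤ} {v u} (h : Lay w.length a v u) : RR (w ++ [a]) v u :=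
  RR.of (iadj_append.2 (Or.inr h))

def KK (w : List ℤ) (a : ℤ) (v u : ℤ × ℕ) : Prop :=
  RR w v u ∨ (RR w v (a-1, w.length) ∧ RR w (a, w.length) u) ∨
    (RR w v (a, w.length) ∧ RR w (a-1, w.length) u)

theorem KK.symm {w a v u} (h : KK w a v u) : KK w a u v := by
  rcases h with h | h | h
  · exact Or.inl h.symm
  · exact Or.inr (Or.inr ⟨h.2.symm, h.1.symm⟩)
  · exact Or.inr (Or.inl ⟨h.2.symm, h.1.symm⟩)

theorem KK.trans {w a v u z} (h : KK w a v u) (h' : KK w a u z) : KK w a v z := by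
  rcases h with h | h | h <;> rcases h' with h' | h' | h'
  · exact Or.inl (h.trans h')
  · exact Or.inr (Or.inl ⟨h.trans h'.1, h'.2⟩)
  · exact Or.inr (Or.inr ⟨h.trans h'.1, h'.2⟩)
  · exact Or.inr (Or.inl ⟨h.1, h.2.trans h'⟩)
  · exact Or.inr (Or.inl ⟨h.1, h'.2⟩)
  · exact Or.inl (h.1.trans h'.2)
  · exact Or.inr (Or.inr ⟨h.1, h.2.trans h'⟩)
  · exact Or.inl (h.1.trans h'.2)
  · exact Or.inr (Or.inr ⟨h.1, h'.2⟩)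

def cls (w : List ℤ) (a : ℤ) (v : ℤ × ℕ) : Set (ℤ × ℕ) := {u | KK w a v u}

theorem cls_eq {w a v u} : cls w a v = cls w a u ↔ KK w a v u := by
  constructor
  · intro h
    have : u ∈ cls w a u := Or.inl (RR.refl _ _)
    rwa [← h] at this
  · intro h
    ext z
    exact ⟨fun hz => h.symm.trans hz, fun hz => h.trans hz⟩

open Classical in
noncomputable def lab (w : List ℤ) (a : ℤ) (v : ℤ × ℕ) : Option (Set (ℤ × ℕ)) :=
  if v.2 = w.length + 1 then (if v.1 = a - 1 ∨ v.1 = a then none else some (cls w a (v.1, w.length)))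
  else some (cls w a v)

theorem lab_le {w a v} (h : v.2 ≤ w.length) : lab w a v = some (cls w a v) := by
  rw [lab, if_neg (by omega)]

theorem lab_bot {w a x} (h1 : x ≠ a - 1) (h2 : x ≠ a) :
    lab w a (x, w.length + 1) = some (cls w a (x, w.length)) := by
  rw [lab, if_pos rfl, if_neg (by simp [h1, h2])]

theorem lab_none {w a x} (h1 : x = a - 1 ∨ x = a) : lab w a (x, w.length + 1) = none := by
  rw [lab, if_pos rfl, if_pos h1]

theorem lab_adj {w a v u} (h : IAdj (w ++ [a]) v u) : lab w a v = lab w a u := by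
  rcases iadj_append.1 h with h | h | ⟨rfl, rfl⟩ | ⟨rfl, rfl⟩
  · rw [lab_le h.level.1, lab_le h.level.2, cls_eq.2 (Or.inl (RR.of h))]
  · obtain ⟨v1, v2⟩ := v
    obtain ⟨u1, u2⟩ := u
    obtain ⟨h1, h2, h3, h4, h5⟩ := h
    simp only at h1 h2 h3 h4 h5
    subst h3 h4 h5
    rw [lab_le le_rfl, lab_bot h1 h2]
  · rw [lab_le le_rfl, lab_le le_rfl, cls_eq.2 (Or.inr (Or.inl ⟨RR.refl _ _, RR.refl _ _⟩))]
  · rw [lab_none (Or.inl rfl), lab_none (Or.inr rfl)]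

theorem lab_rr {w a v u} (h : RR (w ++ [a]) v u) : lab w a v = lab w a u := by
  induction h with
  | refl => rfl
  | tail _ h ih =>
    rw [ih]
    rcases h with h | h
    · exact lab_adj h
    · exact (lab_adj h).symm

theorem KK.rr {w a v u} (h : KK w a v u) : RR (w ++ [a]) v u := by
  have hl : RR (w ++ [a]) (a-1, w.length) (a, w.length) := RR.lay (Or.inr (Or.inl ⟨rfl, rfl⟩))
  rcases h with h | h | h
  · exact h.mono
  · exact h.1.mono.trans (hl.trans h.2.mono)
  · exact h.1.mono.trans (hl.symm.trans h.2.mono)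

theorem rr_le {w a v u} (hv : v.2 ≤ w.length) (hu : u.2 ≤ w.length) :
    RR (w ++ [a]) v u ↔ KK w a v u := by
  refine ⟨fun h => ?_, KK.rr⟩
  have := lab_rr h
  rw [lab_le hv, lab_le hu, Option.some.injEq, cls_eq] at this
  exact this

theorem rr_down {w : List ℤ} {a x} (h1 : x ≠ a - 1) (h2 : x ≠ a) :
    RR (w ++ [a]) (x, w.length + 1) (x, w.length) := by
  have : RR (w ++ [a]) (x, w.length) (x, w.length + 1) := RR.lay (Or.inl ⟨h1, h2, rfl, rfl, rfl⟩)
  exact this.symm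

theorem rr_arc {w : List ℤ} {a : ℤ} :
    RR (w ++ [a]) (a - 1, w.length + 1) (a, w.length + 1) :=
  RR.lay (Or.inr (Or.inr ⟨rfl, rfl⟩))

theorem rr_bot {w : List ℤ} {a x u} (h1 : x ≠ a - 1) (h2 : x ≠ a) (hu : u.2 ≤ w.length) :
    RR (w ++ [a]) (x, w.length + 1) u ↔ KK w a (x, w.length) u := by
  rw [← rr_le (by simp) hu]
  exact ⟨fun h => (rr_down h1 h2).symm.trans h, fun h => (rr_down h1 h2).trans h⟩

theorem rr_iso {w : List ℤ} {a x u} (h1 : x = a - 1 ∨ x = a)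
    (h : RR (w ++ [a]) (x, w.length + 1) u) : u.2 = w.length + 1 ∧ (u.1 = a - 1 ∨ u.1 = a) := by
  have := lab_rr h
  rw [lab_none h1] at this
  rw [lab] at this
  split_ifs at this with h3 h4
  exact ⟨h3, h4⟩

structure Inv (w : List ℤ) (g : ℤ → ℤ) : Prop where
  i1 : ∀ x y, x ≠ y → (RR w (x, w.length) (y, w.length) ↔ MM g x y)
  i2 : ∀ x, UR g x → ∃ t, 0 ≤ t ∧ RR w (x, w.length) (t, 0)
  i2' : ∀ x, UL g x → ∃ t, t < 0 ∧ RR w (x, w.length) (t, 0)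
  i3 : ∀ x y t, MM g x y → ¬ RR w (x, w.length) (t, 0)
  i4 : ∀ s t, s ≠ t → RR w (s, 0) (t, 0) → (s < 0 ∧ 0 ≤ t) ∨ (t < 0 ∧ 0 ≤ s)
  i5 : ∀ x s t, RR w (x, w.length) (s, 0) → RR w (x, w.length) (t, 0) → s = t
  i6 : ∀ x l, l ≤ w.length → ∃ y, RR w (x, l) (y, 0) ∨ RR w (x, l) (y, w.length)

theorem rr_nil {v u} (h : RR [] v u) : u = v := by
  induction h with
  | refl => rfl
  | tail _ h ih =>
    rcases h with ⟨m, a, h, _⟩ | ⟨m, a, h, _⟩ <;> simp at h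

theorem inv0 : Inv [] (fun j => |j|) where
  i1 := fun x y hxy => ⟨fun h => by have := rr_nil h; simp at this; omega, fun h => (mm0 h).elim⟩
  i2 := fun x h => ⟨x, by
    have := h (x+1) (by omega); simp only at this; grind, RR.refl _ _⟩
  i2' := fun x h => ⟨x, by
    have := h x (by omega); simp only at this; grind, RR.refl _ _⟩
  i3 := fun x y t h => (mm0 h).elim
  i4 := fun s t hst h => by have := rr_nil h; simp at this; omega
  i5 := fun x s t h h' => by
    have := rr_nil h; have := rr_nil h'; simp_all
  i6 := fun x l hl => ⟨x, by
    have : l = 0 := by simpa using hl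
    subst this; exact Or.inl (RR.refl _ _)⟩

theorem inv_step {w g g' a} (hg : US g) (I : Inv w g) (ha : Alive g a) (T : TrM g g' a) (hg' : US g') :
    Inv (w ++ [a]) g' := by
  have hlen : (w ++ [a]).length = w.length + 1 := by simp
  obtain ⟨A1, A2, A3⟩ := ha
  have ee : a ≠ a - 1 := by omega
  have nR : ¬ RR w (a-1, w.length) (a, w.length) := fun h => A1 ((I.i1 _ _ ee.symm).1 h)
  -- new status of x from old one
  have st : ∀ x, x ≠ a - 1 → x ≠ a →
      (UR g' x ∧ ∃ t, 0 ≤ t ∧ KK w a (x, w.length) (t, 0)) ∨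
      (UL g' x ∧ ∃ t, t < 0 ∧ KK w a (x, w.length) (t, 0)) ∨
      (∃ y, y ≠ a - 1 ∧ y ≠ a ∧ MM g' x y ∧ KK w a (x, w.length) (y, w.length)) := by
    intro x h1 h2
    rcases status hg x with h | h | ⟨y, h⟩
    · obtain ⟨t, ht, hr⟩ := I.i2 x h
      exact Or.inl ⟨T.t3 x h1 h2 h, t, ht, Or.inl hr⟩
    · obtain ⟨t, ht, hr⟩ := I.i2' x h
      exact Or.inr (Or.inl ⟨T.t3' x h1 h2 h, t, ht, Or.inl hr⟩)
    · have hr := (I.i1 x y (MM_ne h)).2 h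
      by_cases c1 : y = a - 1
      · subst c1
        rcases status hg a with k | k | ⟨z, k⟩
        · obtain ⟨t, ht, hr'⟩ := I.i2 _ k
          exact Or.inl ⟨T.t4 x h1 h2 h k, t, ht, Or.inr (Or.inl ⟨hr, hr'⟩)⟩
        · obtain ⟨t, ht, hr'⟩ := I.i2' _ k
          exact Or.inr (Or.inl ⟨T.t4' x h1 h2 h k, t, ht, Or.inr (Or.inl ⟨hr, hr'⟩)⟩)
        · have z1 : z ≠ a - 1 := by rintro rfl; exact A1 k.symm
          have z2 : z ≠ a := (MM_ne k).symm
          exact Or.inr (Or.inr ⟨z, z1, z2, T.t2 x z h1 h2 z1 z2 h k,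
            Or.inr (Or.inl ⟨hr, (I.i1 _ _ (MM_ne k)).2 k⟩)⟩)
      by_cases c2 : y = a
      · subst c2
        rcases status hg (y-1) with k | k | ⟨z, k⟩
        · obtain ⟨t, ht, hr'⟩ := I.i2 _ k
          exact Or.inl ⟨T.t5 x h1 h2 h k, t, ht, Or.inr (Or.inr ⟨hr, hr'⟩)⟩
        · obtain ⟨t, ht, hr'⟩ := I.i2' _ k
          exact Or.inr (Or.inl ⟨T.t5' x h1 h2 h k, t, ht, Or.inr (Or.inr ⟨hr, hr'⟩)⟩)
        · have z1 : z ≠ y - 1 := (MM_ne k).symm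
          have z2 : z ≠ y := by rintro rfl; exact A1 k
          exact Or.inr (Or.inr ⟨z, z1, z2, (T.t2 z x z1 z2 h1 h2 k.symm h.symm).symm,
            Or.inr (Or.inr ⟨hr, (I.i1 _ _ (MM_ne k)).2 k⟩)⟩)
      · exact Or.inr (Or.inr ⟨y, c1, c2, T.t1 x y h1 h2 c1 c2 h, Or.inl hr⟩)
  -- uniqueness of top ends
  have uq : ∀ x s t, x ≠ a - 1 → x ≠ a → KK w a (x, w.length) (s, 0) →
      KK w a (x, w.length) (t, 0) → s = t := by
    intro x s t h1 h2 hs ht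
    have q1 : ∀ t, RR w (x, w.length) (t, 0) → ¬ RR w (x, w.length) (a-1, w.length) :=
      fun t h h' => I.i3 _ _ _ ((I.i1 _ _ h1).1 h') h
    have q2 : ∀ t, RR w (x, w.length) (t, 0) → ¬ RR w (x, w.length) (a, w.length) :=
      fun t h h' => I.i3 _ _ _ ((I.i1 _ _ h2).1 h') h
    rcases hs with hs | hs | hs <;> rcases ht with ht | ht | ht
    · exact I.i5 _ _ _ hs ht
    · exact (q1 _ hs ht.1).elim
    · exact (q2 _ hs ht.1).elim
    · exact (q1 _ ht hs.1).elim
    · exact I.i5 _ _ _ hs.2 ht.2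
    · exact (nR (hs.1.symm.trans ht.1)).elim
    · exact (q2 _ ht hs.1).elim
    · exact (nR (ht.1.symm.trans hs.1)).elim
    · exact I.i5 _ _ _ hs.2 ht.2
  have tm : ∀ x y t, x ≠ a - 1 → x ≠ a → MM g' x y → ¬ KK w a (x, w.length) (t, 0) := by
    intro x y t h1 h2 hm hk
    rcases hk with hk | hk | hk
    · rcases status hg x with h | h | ⟨z, h⟩
      · exact UR_MM (T.t3 x h1 h2 h) hm
      · exact UL_MM (T.t3' x h1 h2 h) hm
      · exact I.i3 _ _ _ h hk
    · have hx := (I.i1 _ _ h1).1 hk.1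
      rcases status hg a with h | h | ⟨z, h⟩
      · exact UR_MM (T.t4 x h1 h2 hx h) hm
      · exact UL_MM (T.t4' x h1 h2 hx h) hm
      · exact I.i3 _ _ _ h hk.2
    · have hx := (I.i1 _ _ h2).1 hk.1
      rcases status hg (a-1) with h | h | ⟨z, h⟩
      · exact UR_MM (T.t5 x h1 h2 hx h) hm
      · exact UL_MM (T.t5' x h1 h2 hx h) hm
      · exact I.i3 _ _ _ h hk.2
  have nb : ∀ x, ¬ (x ≠ a - 1 ∧ x ≠ a) → x = a - 1 ∨ x = a := fun x h => by omega
  have mnb : ∀ x, (x = a - 1 ∨ x = a) → ∃ y, MM g' x y := by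
    rintro x (rfl | rfl)
    · exact ⟨_, T.t0⟩
    · exact ⟨_, T.t0.symm⟩
  refine ⟨?_, ?_, ?_, ?_, ?_, ?_, ?_⟩ <;> try rw [hlen]
  · intro x y hxy
    by_cases cx : x ≠ a - 1 ∧ x ≠ a
    · obtain ⟨h1, h2⟩ := cx
      constructor
      · intro h
        by_cases cy : y ≠ a - 1 ∧ y ≠ a
        · have h := (rr_bot h1 h2 le_rfl).1 (h.trans (rr_down cy.1 cy.2))
          rcases h with h | h | h
          · exact T.t1 x y h1 h2 cy.1 cy.2 ((I.i1 _ _ hxy).1 h)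
          · exact T.t2 x y h1 h2 cy.1 cy.2 ((I.i1 _ _ h1).1 h.1) ((I.i1 _ _ cy.2.symm).1 h.2)
          · exact (T.t2 y x cy.1 cy.2 h1 h2 ((I.i1 _ _ cy.1).1 h.2.symm)
              ((I.i1 _ _ h2.symm).1 h.1.symm)).symm
        · have := (rr_iso (nb y cy) h.symm).2
          simp only at this
          omega
      · intro hm
        rcases st x h1 h2 with h | h | ⟨z, z1, z2, h, hk⟩
        · exact (UR_MM h.1 hm).elim
        · exact (UL_MM h.1 hm).elim
        · rw [MM_uniq hm h]
          exact ((rr_bot h1 h2 le_rfl).2 hk).trans (rr_down z1 z2).symm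
    · constructor
      · intro h
        have := (rr_iso (nb x cx) h).2
        simp only at this
        rcases nb x cx with rfl | rfl
        · have : y = a := by omega
          subst this; exact T.t0
        · have : y = x - 1 := by omega
          subst this; exact T.t0.symm
      · intro hm
        rcases nb x cx with rfl | rfl
        · rw [MM_uniq hm T.t0]; exact rr_arc
        · rw [MM_uniq hm T.t0.symm]; exact rr_arc.symm
  · intro x hx
    by_cases cx : x ≠ a - 1 ∧ x ≠ a
    · rcases st x cx.1 cx.2 with ⟨_, t, h1, h2⟩ | h | ⟨z, z1, z2, h, hk⟩
      · exact ⟨t, h1, (rr_bot cx.1 cx.2 (Nat.zero_le _)).2 h2⟩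
      · exact (UR_UL hx h.1).elim
      · exact (UR_MM hx h).elim
    · obtain ⟨y, hy⟩ := mnb x (nb x cx)
      exact (UR_MM hx hy).elim
  · intro x hx
    by_cases cx : x ≠ a - 1 ∧ x ≠ a
    · rcases st x cx.1 cx.2 with h | ⟨_, t, h1, h2⟩ | ⟨z, z1, z2, h, hk⟩
      · exact (UR_UL h.1 hx).elim
      · exact ⟨t, h1, (rr_bot cx.1 cx.2 (Nat.zero_le _)).2 h2⟩
      · exact (UL_MM hx h).elim
    · obtain ⟨y, hy⟩ := mnb x (nb x cx)
      exact (UL_MM hx hy).elim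
  · intro x y t hm h
    by_cases cx : x ≠ a - 1 ∧ x ≠ a
    · exact tm x y t cx.1 cx.2 hm ((rr_bot cx.1 cx.2 (Nat.zero_le _)).1 h)
    · have := (rr_iso (nb x cx) h).1
      simp at this
  · have main : ∀ s t, RR w (s, 0) (a-1, w.length) → RR w (a, w.length) (t, 0) → s < 0 ∧ 0 ≤ t := by
      intro s t h1 h2
      have ea : a - 1 + 1 = a := by omega
      rcases status hg (a-1) with h | h | ⟨z, h⟩
      · rcases status hg a with k | k | ⟨z, k⟩
        · exact (A2 ⟨h, k⟩).elim
        · exfalso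
          have q1 := h a (by omega)
          have q2 := k a le_rfl
          have q3 := hg (a-1)
          have q4 := hg a
          rw [ea] at q3
          refine A1 (Or.inl ⟨by omega, by omega, fun j hj hj2 => ?_⟩)
          have : j = a := by omega
          subst this; exact q1
        · exact (I.i3 _ _ _ k h2).elim
      · rcases status hg a with k | k | ⟨z, k⟩
        · obtain ⟨t', ht', hr'⟩ := I.i2 _ k
          obtain ⟨s', hs', hr⟩ := I.i2' _ h
          rw [I.i5 _ _ _ h1.symm hr, I.i5 _ _ _ h2 hr']
          exact ⟨hs', ht'⟩
        · exact (A3 ⟨h, k⟩).elim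
        · exact (I.i3 _ _ _ k h2).elim
      · exact (I.i3 _ _ _ h h1.symm).elim
    intro s t hst h
    rcases (rr_le (Nat.zero_le _) (Nat.zero_le _)).1 h with h | h | h
    · exact I.i4 s t hst h
    · exact Or.inl (main s t h.1 h.2)
    · exact Or.inr (main t s h.2.symm h.1.symm)
  · intro x s t h1 h2
    by_cases cx : x ≠ a - 1 ∧ x ≠ a
    · exact uq x s t cx.1 cx.2 ((rr_bot cx.1 cx.2 (Nat.zero_le _)).1 h1)
        ((rr_bot cx.1 cx.2 (Nat.zero_le _)).1 h2)
    · have := (rr_iso (nb x cx) h1).1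
      simp at this
  · intro x l hl
    by_cases cl : l = w.length + 1
    · subst cl; exact ⟨x, Or.inr (RR.refl _ _)⟩
    have arc : RR (w ++ [a]) (a-1, w.length) (a, w.length) := RR.lay (Or.inr (Or.inl ⟨rfl, rfl⟩))
    have ends : ∀ b, (b = a - 1 ∨ b = a) → ∃ z, RR (w ++ [a]) (b, w.length) (z, 0) ∨
        RR (w ++ [a]) (b, w.length) (z, w.length + 1) := by
      intro b hb
      rcases status hg b with k | k | ⟨z, k⟩
      · obtain ⟨t', _, hr'⟩ := I.i2 _ k
        exact ⟨t', Or.inl hr'.mono⟩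
      · obtain ⟨t', _, hr'⟩ := I.i2' _ k
        exact ⟨t', Or.inl hr'.mono⟩
      · have z1 : z ≠ a - 1 := by
          rintro rfl
          rcases hb with rfl | rfl
          · exact MM_ne k rfl
          · exact A1 k.symm
        have z2 : z ≠ a := by
          rintro rfl
          rcases hb with rfl | rfl
          · exact A1 k
          · exact MM_ne k rfl
        exact ⟨z, Or.inr (((I.i1 _ _ (MM_ne k)).2 k).mono.trans (rr_down z1 z2).symm)⟩
    obtain ⟨y, h | h⟩ := I.i6 x l (by omega)
    · exact ⟨y, Or.inl h.mono⟩
    · by_cases cy : y ≠ a - 1 ∧ y ≠ a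
      · exact ⟨y, Or.inr (h.mono.trans (rr_down cy.1 cy.2).symm)⟩
      · obtain ⟨z, hz⟩ := ends y (nb y cy)
        exact ⟨z, hz.imp (fun k => h.mono.trans k) (fun k => h.mono.trans k)⟩

def Bad (il : List ℤ) : Prop :=
  (∃ v : ℤ × ℕ, 0 < v.2 ∧ v.2 < il.length ∧ ∀ u, RR il v u → 0 < u.2 ∧ u.2 < il.length) ∨
  (∃ s t, s ≠ t ∧ RR il (s, 0) (t, 0) ∧ ¬ ((s < 0 ∧ 0 ≤ t) ∨ (t < 0 ∧ 0 ≤ s)))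

theorem bad_mono {w a} (h : Bad w) : Bad (w ++ [a]) := by
  have hlen : (w ++ [a]).length = w.length + 1 := by simp
  rcases h with ⟨v, h1, h2, h3⟩ | ⟨s, t, h1, h2, h3⟩
  · left
    have key : ∀ u, RR (w ++ [a]) v u → RR w v u := by
      intro u hu
      induction hu with
      | refl => exact RR.refl _ _
      | @tail b c hb hbc ih =>
        have lb := h3 b ih
        rcases hbc with hbc | hbc
        · rcases iadj_append.1 hbc with k | k | ⟨rfl, rfl⟩ | ⟨rfl, rfl⟩
          · exact ih.trans (RR.of k)
          · omega
          · simp at lb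
          · simp at lb
        · rcases iadj_append.1 hbc with k | k | ⟨rfl, rfl⟩ | ⟨rfl, rfl⟩
          · exact ih.trans (RR.of k).symm
          · omega
          · simp at lb
          · simp at lb
    refine ⟨v, h1, by omega, fun u hu => ?_⟩
    have := h3 u (key u hu)
    omega
  · exact Or.inr ⟨s, t, h1, h2.mono, h3⟩

theorem bad_dead {w g a} (hg : US g) (I : Inv w g) (ha : ¬ Alive g a) : Bad (w ++ [a]) := by
  have hlen : (w ++ [a]).length = w.length + 1 := by simp
  have ee : a - 1 ≠ a := by omega
  by_cases c1 : MM g (a-1) a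
  · left
    have hr := (I.i1 _ _ ee).2 c1
    have hn : w.length ≠ 0 := by
      intro h0
      have := I.i3 _ _ (a-1) c1
      rw [h0] at this
      exact this (RR.refl _ _)
    have kk : ∀ u, KK w a (a-1, w.length) u → RR w (a-1, w.length) u := by
      rintro u (h | h | h)
      · exact h
      · exact hr.trans h.2
      · exact h.2
    refine ⟨(a-1, w.length), by simp only; omega, by simp, fun u hu => ?_⟩
    obtain ⟨x, l⟩ := u
    simp only
    have hl : l ≤ w.length + 1 := by
      rcases hu.level with h | h
      · simp at h; omega
      · simpa using h
    by_cases c2 : l = w.length + 1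
    · exfalso
      subst c2
      by_cases cx : x ≠ a - 1 ∧ x ≠ a
      · have := kk _ (((rr_bot cx.1 cx.2 (by simp)).1 hu.symm).symm)
        exact cx.2 (MM_uniq c1 ((I.i1 _ _ cx.1.symm).1 this)).symm
      · have := (rr_iso (by omega) hu.symm).1
        simp at this
    · have := kk _ ((rr_le (by simp) (by simp only; omega)).1 hu)
      refine ⟨?_, by omega⟩
      by_contra h0
      have : l = 0 := by omega
      subst this
      exact I.i3 _ _ _ c1 (by assumption)
  · right
    have fin : ∀ s t, RR w (a-1, w.length) (s, 0) → RR w (a, w.length) (t, 0) →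
        s ≠ t ∧ RR (w ++ [a]) (s, 0) (t, 0) := by
      intro s t h1 h2
      refine ⟨?_, KK.rr (Or.inr (Or.inl ⟨h1.symm, h2⟩))⟩
      rintro rfl
      exact c1 ((I.i1 _ _ ee).1 (h1.trans h2.symm))
    by_cases c2 : UR g (a-1) ∧ UR g a
    · obtain ⟨s, hs, h1⟩ := I.i2 _ c2.1
      obtain ⟨t, ht, h2⟩ := I.i2 _ c2.2
      exact ⟨s, t, (fin s t h1 h2).1, (fin s t h1 h2).2, by omega⟩
    by_cases c3 : UL g (a-1) ∧ UL g a
    · obtain ⟨s, hs, h1⟩ := I.i2' _ c3.1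
      obtain ⟨t, ht, h2⟩ := I.i2' _ c3.2
      exact ⟨s, t, (fin s t h1 h2).1, (fin s t h1 h2).2, by omega⟩
    · exact (ha ⟨c1, c2, c3⟩).elim


def dots (μ : YoungDiagram) : Set ℤ := {j | ∃ i : ℕ, j = (μ.rowLen i : ℤ) - i - 1}

def AddR (μ ν : YoungDiagram) (r : ℕ) : Prop :=
  ν.rowLen r = μ.rowLen r + 1 ∧ ∀ i, i ≠ r → ν.rowLen i = μ.rowLen i

theorem addR_of {μ ν : YoungDiagram} {b : ℕ × ℕ} (h1 : b ∉ μ.cells)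
    (h2 : ν.cells = insert b μ.cells) : AddR μ ν b.1 ∧ μ.rowLen b.1 = b.2 := by
  obtain ⟨r, c⟩ := b
  have hm : ∀ i j, j < ν.rowLen i ↔ ((i = r ∧ j = c) ∨ j < μ.rowLen i) := by
    intro i j
    rw [← YoungDiagram.mem_iff_lt_rowLen, ← YoungDiagram.mem_iff_lt_rowLen,
      ← YoungDiagram.mem_cells, ← YoungDiagram.mem_cells, h2, Finset.mem_insert, Prod.mk.injEq]
  have h1' : ¬ c < μ.rowLen r := by
    rw [← YoungDiagram.mem_iff_lt_rowLen, ← YoungDiagram.mem_cells]; exact h1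
  have e1 : μ.rowLen r = c := by
    have q1 := (hm r c).2 (Or.inl ⟨rfl, rfl⟩)
    have q2 := hm r (c-1)
    omega
  refine ⟨⟨?_, fun i hi => ?_⟩, e1⟩
  · simp only
    have q1 := (hm r c).2 (Or.inl ⟨rfl, rfl⟩)
    have q2 := hm r (c+1)
    omega
  · simp only at hi
    have q1 := hm i (μ.rowLen i)
    have q2 := hm i (ν.rowLen i)
    omega

theorem rl_anti (μ : YoungDiagram) {i k : ℕ} (h : i ≤ k) : μ.rowLen k ≤ μ.rowLen i :=
  μ.rowLen_anti i k h

theorem dots_inj {μ : YoungDiagram} {i k : ℕ}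
    (h : (μ.rowLen i : ℤ) - i = (μ.rowLen k : ℤ) - k) : i = k := by
  rcases lt_trichotomy i k with h' | h' | h'
  · have := rl_anti μ h'.le; omega
  · exact h'
  · have := rl_anti μ h'.le; omega

theorem addR_stp {μ ν : YoungDiagram} {r : ℕ} (h : AddR μ ν r) :
    Stp1 (dots μ) (dots ν) ((μ.rowLen r : ℤ) - r) ((μ.rowLen r : ℤ) - r - 1) := by
  obtain ⟨h1, h2⟩ := h
  refine ⟨?_, ⟨r, rfl⟩, fun j => ?_⟩
  · rintro ⟨i, hi⟩
    have ne : i ≠ r := by rintro rfl; omega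
    have hi2 := h2 i ne
    have : (ν.rowLen i : ℤ) - i = (ν.rowLen r : ℤ) - r := by omega
    exact ne (dots_inj this)
  · constructor
    · rintro ⟨i, hi⟩
      by_cases e : i = r
      · subst e; left; omega
      · right
        refine ⟨⟨i, by rw [hi, h2 i e]⟩, fun hj => e (dots_inj (μ := μ) ?_)⟩
        rw [h2 i e] at hi; omega
    · rintro (rfl | ⟨⟨i, hi⟩, hj⟩)
      · exact ⟨r, by omega⟩
      · have e : i ≠ r := by rintro rfl; exact hj hi
        exact ⟨i, by rw [h2 i e]; exact hi⟩

theorem Stp1.rev {S T a b} (h : Stp1 S T a b) : Stp1 T S b a := by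
  obtain ⟨h1, h2, h3⟩ := h
  have ne : a ≠ b := by rintro rfl; exact h1 h2
  refine ⟨fun h => ?_, (h3 a).2 (Or.inl rfl), fun j => ?_⟩
  · rcases (h3 b).1 h with h | h
    · exact ne h.symm
    · exact h.2 rfl
  · constructor
    · intro hj
      by_cases e : j = b
      · exact Or.inl e
      · exact Or.inr ⟨(h3 j).2 (Or.inr ⟨hj, e⟩), by rintro rfl; exact h1 hj⟩
    · rintro (rfl | ⟨h, h'⟩)
      · exact h2
      · rcases (h3 j).1 h with h | h
        · exact (h' h).elim
        · exact h.1

theorem Stp1.det {S S' T a b} (h : Stp1 S T a b) (h' : Stp1 S' T a b) : S = S' := by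
  ext j
  rw [h.rev.2.2 j, h'.rev.2.2 j]

theorem step_stp {μ ν : YoungDiagram} {a : ℤ} (h : UDStepRes μ ν a) : Stp (dots μ) (dots ν) a := by
  rcases h with ⟨b, h1, h2, h3⟩ | ⟨b, h1, h2, h3⟩
  · obtain ⟨k1, k2⟩ := addR_of h1 h2
    have := addR_stp k1
    rw [k2, ← h3] at this
    exact Or.inl this
  · have h1' : b ∉ ν.cells := by rw [h2]; simp
    have h2' : μ.cells = insert b ν.cells := by rw [h2, Finset.insert_erase h1]
    obtain ⟨k1, k2⟩ := addR_of h1' h2'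
    have := (addR_stp k1).rev
    rw [k2, ← h3] at this
    right
    have e : (b.2 : ℤ) - b.1 = a + 1 := by omega
    rwa [e] at this

theorem stp_step {ν : YoungDiagram} {S : Set ℤ} {a : ℤ} (h : Stp S (dots ν) a) :
    ∃ μ, dots μ = S ∧ UDStepRes μ ν a := by
  rcases h with h | h
  · obtain ⟨r, hr⟩ := (h.2.2 a).2 (Or.inl rfl)
    have hn : ν.rowLen (r+1) < ν.rowLen r := by
      by_contra hc
      have := rl_anti ν (show r ≤ r + 1 by omega)
      refine h.rev.1 ⟨r+1, ?_⟩
      push_cast; omega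
    have hin : (r, ν.rowLen r - 1) ∈ ν.cells := by
      rw [YoungDiagram.mem_cells, YoungDiagram.mem_iff_lt_rowLen]; omega
    let μ : YoungDiagram := ⟨ν.cells.erase (r, ν.rowLen r - 1), by
      rintro ⟨i, j⟩ ⟨i', j'⟩ hle hm
      simp only [Finset.coe_erase, Set.mem_sdiff, Set.mem_singleton_iff, Finset.mem_coe,
        YoungDiagram.mem_cells, YoungDiagram.mem_iff_lt_rowLen, Prod.mk.injEq] at hm ⊢
      obtain ⟨l1, l2⟩ := Prod.mk_le_mk.1 hle
      have := rl_anti ν l1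
      refine ⟨by omega, ?_⟩
      rintro ⟨rfl, rfl⟩
      by_cases e : i = i'
      · subst e; omega
      · have := rl_anti ν (show i' + 1 ≤ i by omega)
        omega⟩
    have b1 : (r, ν.rowLen r - 1) ∉ μ.cells := by simp [μ]
    have b2 : ν.cells = insert (r, ν.rowLen r - 1) μ.cells := by
      simp only [μ]; rw [Finset.insert_erase hin]
    have st : UDStepRes μ ν a := Or.inl ⟨_, b1, b2, by simp only; omega⟩
    refine ⟨μ, ?_, st⟩
    obtain ⟨k1, k2⟩ := addR_of b1 b2
    have := addR_stp k1
    simp only at k2 this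
    rw [k2] at this
    have e : ((ν.rowLen r - 1 : ℕ) : ℤ) - r = a := by omega
    rw [e] at this
    exact this.det h
  · obtain ⟨r, hr⟩ := (h.2.2 a).2 (Or.inl rfl)
    have hn : ∀ i, i < r → ν.rowLen r < ν.rowLen i := by
      intro i hi
      have q1 := rl_anti ν (show i ≤ r - 1 by omega)
      have q2 := rl_anti ν (show r - 1 ≤ r by omega)
      by_contra hc
      refine h.rev.1 ⟨r-1, ?_⟩
      omega
    let μ : YoungDiagram := ⟨insert (r, ν.rowLen r) ν.cells, by
      rintro ⟨i, j⟩ ⟨i', j'⟩ hle hm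
      simp only [Finset.coe_insert, Set.mem_insert_iff, Finset.mem_coe,
        YoungDiagram.mem_cells, YoungDiagram.mem_iff_lt_rowLen, Prod.mk.injEq] at hm ⊢
      obtain ⟨l1, l2⟩ := Prod.mk_le_mk.1 hle
      have := rl_anti ν l1
      rcases hm with ⟨rfl, rfl⟩ | hm
      · by_cases e : i = i'
        · subst e; omega
        · have := hn i' (by omega)
          omega
      · right; omega⟩
    have b1 : (r, ν.rowLen r) ∉ ν.cells := by
      rw [YoungDiagram.mem_cells, YoungDiagram.mem_iff_lt_rowLen]; omega
    have b2 : μ.cells = insert (r, ν.rowLen r) ν.cells := rfl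
    have st : UDStepRes μ ν a := Or.inr ⟨(r, ν.rowLen r), by rw [b2]; simp, by
      rw [b2, Finset.erase_insert b1], by simp only; omega⟩
    refine ⟨μ, ?_, st⟩
    obtain ⟨k1, k2⟩ := addR_of b1 b2
    have := (addR_stp k1).rev
    simp only at this
    have e : (ν.rowLen r : ℤ) - r = a + 1 := by omega
    rw [e, show a + 1 - 1 = a by omega] at this
    exact this.det h

theorem rl_bot (i : ℕ) : (⊥ : YoungDiagram).rowLen i = 0 := by
  by_contra h
  have : (i, 0) ∈ (⊥ : YoungDiagram) := by
    rw [YoungDiagram.mem_iff_lt_rowLen]; omega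
  simp at this

theorem dots_bot : dots ⊥ = {j | j < 0} := by
  ext j
  constructor
  · rintro ⟨i, hi⟩
    rw [rl_bot] at hi
    change j < 0
    omega
  · intro (h : j < 0)
    refine ⟨(-j-1).toNat, ?_⟩
    rw [rl_bot]; omega

theorem dots_bot_inv {μ : YoungDiagram} (h : dots μ = {j | j < 0}) : μ = ⊥ := by
  have h0 : (μ.rowLen 0 : ℤ) - (0:ℕ) - 1 ∈ dots μ := ⟨0, rfl⟩
  rw [h] at h0
  have h1 : (μ.rowLen 0 : ℤ) - (0:ℕ) - 1 < 0 := h0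
  ext ⟨i, j⟩
  have := rl_anti μ (Nat.zero_le i)
  rw [YoungDiagram.mem_cells, YoungDiagram.mem_iff_lt_rowLen]
  simp
  omega

theorem tab_append {w : List ℤ} {a : ℤ} {μ ν : YoungDiagram} :
    IsUDTab μ (w ++ [a]) ν ↔ ∃ κ, IsUDTab μ w κ ∧ UDStepRes κ ν a := by
  induction w generalizing μ with
  | nil =>
    simp only [List.nil_append, IsUDTab]
    constructor
    · rintro ⟨μ', h, rfl⟩; exact ⟨μ, rfl, h⟩
    · rintro ⟨κ, rfl, h⟩; exact ⟨ν, h, rfl⟩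
  | cons b w ih =>
    simp only [List.cons_append, IsUDTab, ih]
    constructor
    · rintro ⟨μ', h, κ, h1, h2⟩; exact ⟨κ, ⟨μ', h, h1⟩, h2⟩
    · rintro ⟨κ, ⟨μ', h, h1⟩, h2⟩; exact ⟨μ', h, κ, h1, h2⟩

theorem main_ind (w : List ℤ) :
    (Bad w ∧ ∀ μ, ¬ IsUDTab ⊥ w μ) ∨
    ∃ g, Good g ∧ Inv w g ∧ ∀ μ, IsUDTab ⊥ w μ ↔ AG g (dots μ) := by
  induction w using List.reverseRecOn with
  | nil =>
    refine Or.inr ⟨_, good0, inv0, fun μ => ?_⟩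
    rw [ag0]
    simp only [IsUDTab]
    exact ⟨fun h => by rw [← h, dots_bot], fun h => (dots_bot_inv h).symm⟩
  | append_singleton w a ih =>
    rcases ih with ⟨h1, h2⟩ | ⟨g, hg, I, h⟩
    · left
      refine ⟨bad_mono h1, fun μ hm => ?_⟩
      obtain ⟨κ, k, _⟩ := tab_append.1 hm
      exact h2 κ k
    · by_cases ha : Alive g a
      · right
        obtain ⟨g', hg', hT, hA⟩ := step_alive hg ha
        refine ⟨g', hg', inv_step hg.1 I ha hT hg'.1, fun μ => ?_⟩
        rw [tab_append, hA.iff]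
        constructor
        · rintro ⟨κ, k1, k2⟩
          exact ⟨dots κ, (h κ).1 k1, step_stp k2⟩
        · rintro ⟨S, k1, k2⟩
          obtain ⟨κ, rfl, k3⟩ := stp_step k2
          exact ⟨κ, (h κ).2 k1, k3⟩
      · left
        refine ⟨bad_dead hg.1 I ha, fun μ hm => ?_⟩
        obtain ⟨κ, k1, k2⟩ := tab_append.1 hm
        exact step_dead hg.1 ha ((h κ).1 k1) (step_stp k2)


def PP (v : ℤ × ℕ) : ℚ × ℕ := ((v.1 : ℚ) + 1/2, v.2)

theorem half_eq {x a : ℤ} : (x : ℚ) + 1/2 = (a : ℚ) - 1/2 ↔ x = a - 1 := by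
  constructor
  · intro h
    have : (x : ℚ) = ((a - 1 : ℤ) : ℚ) := by push_cast; linarith
    exact_mod_cast this
  · rintro rfl; push_cast; ring

theorem half_eq' {x a : ℤ} : (x : ℚ) + 1/2 = (a : ℚ) + 1/2 ↔ x = a := by
  constructor
  · intro h
    have : (x : ℚ) = (a : ℚ) := by linarith
    exact_mod_cast this
  · rintro rfl; rfl

theorem PP_inj {v u} (h : PP v = PP u) : v = u := by
  obtain ⟨x, l⟩ := v
  obtain ⟨y, m⟩ := u
  simp only [PP, Prod.mk.injEq] at h
  rw [half_eq'.1 h.1, h.2]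

theorem adj_lift {il : List ℤ} {p q : ℚ × ℕ} (h : StackAdj il p q) :
    ∃ v u, p = PP v ∧ q = PP u ∧ IAdj il v u := by
  obtain ⟨m, a, h1, h⟩ := h
  have e : (a : ℚ) - 1/2 = ((a - 1 : ℤ) : ℚ) + 1/2 := by push_cast; ring
  rcases h with ⟨⟨x, hx⟩, h2, h3, h4, h5, h6⟩ | ⟨rfl, rfl⟩ | ⟨rfl, rfl⟩
  · obtain ⟨p1, p2⟩ := p
    obtain ⟨q1, q2⟩ := q
    simp only at hx h2 h3 h4 h5 h6
    subst h4 hx h5 h6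
    refine ⟨(x, p2), (x, p2 + 1), rfl, rfl, p2, a, h1, Or.inl ⟨?_, ?_, rfl, rfl, rfl⟩⟩
    · exact fun h => h2 (half_eq.2 h)
    · exact fun h => h3 (half_eq'.2 h)
  · exact ⟨(a-1, m), (a, m), by rw [e]; rfl, rfl, m, a, h1, Or.inr (Or.inl ⟨rfl, rfl⟩)⟩
  · exact ⟨(a-1, m+1), (a, m+1), by rw [e]; rfl, rfl, m, a, h1, Or.inr (Or.inr ⟨rfl, rfl⟩)⟩

theorem adj_drop {il : List ℤ} {v u} (h : IAdj il v u) : StackAdj il (PP v) (PP u) := by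
  obtain ⟨m, a, h1, h⟩ := h
  have e : (a : ℚ) - 1/2 = ((a - 1 : ℤ) : ℚ) + 1/2 := by push_cast; ring
  refine ⟨m, a, h1, ?_⟩
  rcases h with ⟨h2, h3, h4, h5, h6⟩ | ⟨rfl, rfl⟩ | ⟨rfl, rfl⟩
  · refine Or.inl ⟨⟨v.1, rfl⟩, fun h => h2 (half_eq.1 h), fun h => h3 (half_eq'.1 h), ?_, h5, h6⟩
    simp only [PP, h4]
  · exact Or.inr (Or.inl ⟨by rw [e]; rfl, rfl⟩)
  · exact Or.inr (Or.inr ⟨by rw [e]; rfl, rfl⟩)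

theorem reach_lift {il : List ℤ} {v : ℤ × ℕ} {q : ℚ × ℕ} (h : StackReach il (PP v) q) :
    ∃ u, q = PP u ∧ RR il v u := by
  induction h with
  | refl => exact ⟨v, rfl, RR.refl _ _⟩
  | tail _ h ih =>
    obtain ⟨u, rfl, hu⟩ := ih
    rcases h with h | h
    · obtain ⟨z, z', h1, h2, h3⟩ := adj_lift h
      have := PP_inj h1
      subst this
      exact ⟨z', h2, hu.trans (RR.of h3)⟩
    · obtain ⟨z, z', h1, h2, h3⟩ := adj_lift h
      have := PP_inj h2
      subst this
      exact ⟨z, h1, hu.trans (RR.of h3).symm⟩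

theorem reach_iff {il : List ℤ} {v u : ℤ × ℕ} : StackReach il (PP v) (PP u) ↔ RR il v u := by
  constructor
  · intro h
    obtain ⟨z, h1, h2⟩ := reach_lift h
    rwa [PP_inj h1]
  · intro h
    induction h with
    | refl => exact Relation.ReflTransGen.refl
    | tail _ h ih =>
      exact Relation.ReflTransGen.tail ih (h.imp adj_drop adj_drop)

theorem half_neg {x : ℤ} : (x : ℚ) + 1/2 < 0 ↔ x < 0 := by
  constructor
  · intro h
    have : (x : ℚ) < ((0 : ℤ) : ℚ) := by push_cast; linarith
    exact_mod_cast this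
  · intro h
    have : (x : ℚ) ≤ ((-1 : ℤ) : ℚ) := by exact_mod_cast (by omega : x ≤ -1)
    push_cast at this; linarith

theorem half_pos' {x : ℤ} : 0 < (x : ℚ) + 1/2 ↔ 0 ≤ x := by
  constructor
  · intro h
    have : ((-1 : ℤ) : ℚ) < (x : ℚ) := by push_cast; linarith
    have : -1 < x := by exact_mod_cast this
    omega
  · intro h
    have : ((0 : ℤ) : ℚ) ≤ (x : ℚ) := by exact_mod_cast h
    push_cast at this; linarith

theorem half_neg1 {x : ℤ} : (x : ℚ) + 1/2 < -1 ↔ x ≤ -2 := by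
  have := half_neg (x := x + 1)
  push_cast at this
  constructor
  · intro h; have := this.1 (by linarith); omega
  · intro h; have := this.2 (by omega); linarith

theorem half_pos1 {x : ℤ} : -1 < (x : ℚ) + 1/2 ↔ -1 ≤ x := by
  have := half_pos' (x := x + 1)
  push_cast at this
  constructor
  · intro h; have := this.1 (by linarith); omega
  · intro h; have := this.2 (by omega); linarith

theorem so_iff {il : List ℤ} : StackOrientable il ↔ ¬ Bad il ∧
    ∀ x y, x ≠ y → RR il (x, il.length) (y, il.length) →
      (x ≤ -2 ∧ -1 ≤ y) ∨ (y ≤ -2 ∧ -1 ≤ x) := by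
  constructor
  · rintro ⟨h1, h2, h3⟩
    refine ⟨?_, fun x y hxy h => ?_⟩
    · rintro (⟨v, k1, k2, k3⟩ | ⟨s, t, k1, k2, k3⟩)
      · refine h1 ⟨PP v, ⟨v.1, rfl⟩, k1, k2, fun q hq => ?_⟩
        obtain ⟨u, rfl, hu⟩ := reach_lift hq
        exact k3 u hu
      · have := h2 ((s : ℚ) + 1/2) ((t : ℚ) + 1/2) ⟨s, rfl⟩ ⟨t, rfl⟩
          (fun h => k1 (half_eq'.1 h)) (reach_iff.2 k2)
        rw [half_neg, half_neg, half_pos', half_pos'] at this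
        exact k3 this
    · have := h3 ((x : ℚ) + 1/2) ((y : ℚ) + 1/2) ⟨x, rfl⟩ ⟨y, rfl⟩
          (fun h => hxy (half_eq'.1 h)) (reach_iff.2 h)
      rwa [half_neg1, half_neg1, half_pos1, half_pos1] at this
  · rintro ⟨h1, h3⟩
    refine ⟨?_, ?_, ?_⟩
    · rintro ⟨⟨p, l⟩, ⟨x, rfl⟩, k1, k2, k3⟩
      exact h1 (Or.inl ⟨(x, l), k1, k2, fun u hu => k3 (PP u) (reach_iff.2 hu)⟩)
    · rintro p q ⟨s, rfl⟩ ⟨t, rfl⟩ hne h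
      rw [half_neg, half_neg, half_pos', half_pos']
      by_contra hc
      exact h1 (Or.inr ⟨s, t, fun h => hne (half_eq'.2 h), reach_iff.1 h, hc⟩)
    · rintro p q ⟨s, rfl⟩ ⟨t, rfl⟩ hne h
      rw [half_neg1, half_neg1, half_pos1, half_pos1]
      exact h3 s t (fun h => hne (half_eq'.2 h)) (reach_iff.1 h)

theorem Inv.not_bad {w g} (I : Inv w g) : ¬ Bad w := by
  rintro (⟨⟨x, l⟩, k1, k2, k3⟩ | ⟨s, t, k1, k2, k3⟩)
  · obtain ⟨y, h | h⟩ := I.i6 x l (by simp only at k2; omega)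
    · have := (k3 _ h).1; simp at this
    · have := (k3 _ h).2; simp at this
  · exact k3 (I.i4 s t k1 k2)

theorem final (il : List ℤ) : IsUDTab ⊥ il ⊥ ↔ StackOrientable il := by
  rw [so_iff]
  rcases main_ind il with ⟨h1, h2⟩ | ⟨g, hg, I, h⟩
  · exact ⟨fun k => (h2 _ k).elim, fun k => (k.1 h1).elim⟩
  · rw [h, dots_bot]
    constructor
    · intro hA
      refine ⟨I.not_bad, fun x y hxy hr => ?_⟩
      rcases (I.i1 x y hxy).1 hr with k | k
      · exact Or.inl (agfin1 hg.1 hA k)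
      · exact Or.inr (agfin1 hg.1 hA k)
    · rintro ⟨_, hb⟩
      refine agfin2 hg fun x y hm => ?_
      have := hb x y (by have := hm.1; omega) ((I.i1 x y (by have := hm.1; omega)).2 (Or.inl hm))
      have := hm.1
      omega

end UDT

/-- A sequence of integers is the target residue sequence of an up-down tableau of shape
`∅` if and only if its stacked diagram is orientable. -/
theorem udTableau_empty_iff_stackOrientable (il : List ℤ) :
    IsUDTab ⊥ il ⊥ ↔ StackOrientable il := by
  exact UDT.final il
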